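/- arXiv:1910.08661 — 3 statements merged into one kernel-verified Lean document; each statement's English description precedes it below -/
import Mathlib

section
/- There is a constant c > 0 such that for every integer k ≥ 2, every positive integer m, and every n ≥ c·m·k²·log k, the following holds: every coloring of {1, 2, …, n} in which no color is used more than m times contains a rainbow k-term arithmetic progression. In other words, the sub-Ramsey number satisfies sr(m,k) ≤ c·m·k²·log k. Here log denotes the natural logarithm. -/
open Finset Nat Chebyshev

theorem log_factorial_eq_sum_primesLE (n : ℕ) :
    Real.log (n ! : ℕ) = ∑ p ∈ primesLE n, ((n !).factorization p : ℝ) * Real.log p := by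
  rw [Real.log_nat_eq_sum_factorization, Finsupp.sum]
  refine Finset.sum_subset (fun p hp ↦ ?_) (fun p _ hp ↦ ?_)
  · rw [Nat.support_factorization, Nat.mem_primeFactors] at hp
    exact mem_primesLE.2 ⟨(hp.1.dvd_factorial).1 hp.2.1, hp.1⟩
  · simp [Finsupp.notMem_support_iff.1 hp]

theorem div_le_factorization_factorial {p : ℕ} (hp : p.Prime) (n : ℕ) :
    n / p ≤ (n !).factorization p := by
  have h := (Nat.factorization_le_iff_dvd (factorial_ne_zero (p * (n / p)))
    (factorial_ne_zero n)).2 (factorial_dvd_factorial (Nat.mul_div_le n p)) p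
  rw [factorization_factorial_mul hp] at h
  omega

/-- The upper half of the first theorem of Mertens. -/
theorem sum_log_div_primesLE_le {n : ℕ} (hn : 0 < n) :
    ∑ p ∈ primesLE n, Real.log p / p ≤ Real.log n + Real.log 4 := by
  have hn' : (0 : ℝ) < n := by exact_mod_cast hn
  have h1 : Real.log (n ! : ℕ) ≤ n * Real.log n := by
    rw [← Real.log_pow]
    exact Real.log_le_log (by positivity) (by exact_mod_cast factorial_le_pow n)
  have h2 := theta_le_log4_mul_x hn'.le
  rw [theta_eq_sum_primesLE_log] at h2
  have h3 : n * ∑ p ∈ primesLE n, Real.log p / p - ∑ p ∈ primesLE n, Real.log p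
      ≤ Real.log (n ! : ℕ) := by
    rw [log_factorial_eq_sum_primesLE, Finset.mul_sum, ← Finset.sum_sub_distrib]
    refine Finset.sum_le_sum fun p hp ↦ ?_
    have hpp := prime_of_mem_primesLE hp
    have hlog : 0 ≤ Real.log p := Real.log_natCast_nonneg p
    have hdiv : (n : ℝ) / p - 1 ≤ (n / p : ℕ) := by
      have := (Nat.lt_floor_add_one ((n : ℝ) / p)).le
      rw [Nat.floor_div_eq_div] at this
      linarith
    have hfac : ((n / p : ℕ) : ℝ) ≤ (n !).factorization p := by
      exact_mod_cast div_le_factorization_factorial hpp n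
    calc (n : ℝ) * (Real.log p / p) - Real.log p = (n / p - 1) * Real.log p := by ring
      _ ≤ _ := by gcongr; linarith
  have h4 : (n : ℝ) * ∑ p ∈ primesLE n, Real.log p / p ≤ n * (Real.log n + Real.log 4) := by
    linarith
  exact le_of_mul_le_mul_left h4 hn'

theorem log_div_pred_le {p : ℕ} (hp : 2 ≤ p) :
    Real.log p / (p - 1) ≤ Real.log p / p + 4 * ((p : ℝ) ^ (3 / 2 : ℝ))⁻¹ := by
  have hp' : (2 : ℝ) ≤ p := by exact_mod_cast hp
  have hlog : Real.log p ≤ 2 * (p : ℝ) ^ (1 / 2 : ℝ) := by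
    have := Real.log_le_rpow_div (x := (p : ℝ)) (by positivity) (ε := 1 / 2) (by norm_num)
    linarith
  have hpow : (p : ℝ) ^ (1 / 2 : ℝ) * (p : ℝ) ^ (3 / 2 : ℝ) = p ^ 2 := by
    rw [← Real.rpow_add (by positivity)]
    norm_num
  have hpos : 0 < (p : ℝ) ^ (3 / 2 : ℝ) := by positivity
  have hinv : ((p : ℝ) ^ (3 / 2 : ℝ))⁻¹ = (p : ℝ) ^ (1 / 2 : ℝ) / p ^ 2 := by
    rw [← hpow]
    field_simp
  have hsplit : Real.log p / (p - 1) - Real.log p / p = Real.log p / (p * (p - 1)) := by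
    have : (p : ℝ) - 1 ≠ 0 := by linarith
    field_simp
    ring
  have hmain : Real.log p / (p * (p - 1)) ≤ 2 * (p : ℝ) ^ (1 / 2 : ℝ) / (p * (p / 2)) := by
    gcongr
    linarith
  rw [hinv]
  calc Real.log p / (p - 1) ≤ Real.log p / p + 2 * (p : ℝ) ^ (1 / 2 : ℝ) / (p * (p / 2)) := by
        linarith
    _ = _ := by field_simp; ring

/-- The lower half of the first theorem of Mertens. -/
theorem exists_log_sub_le_sum_log_div_primesLE :
    ∃ M : ℝ, 0 ≤ M ∧ ∀ n : ℕ, 0 < n →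
      Real.log n - M ≤ ∑ p ∈ primesLE n, Real.log p / p := by
  have hsum : Summable fun p : ℕ ↦ 4 * ((p : ℝ) ^ (3 / 2 : ℝ))⁻¹ :=
    (Real.summable_nat_rpow_inv.2 (by norm_num)).mul_left 4
  refine ⟨1 + ∑' p : ℕ, 4 * ((p : ℝ) ^ (3 / 2 : ℝ))⁻¹, by positivity, fun n hn ↦ ?_⟩
  have hn' : (0 : ℝ) < n := by exact_mod_cast hn
  have h1 : n * Real.log n - n ≤ Real.log (n ! : ℕ) := by
    have := Stirling.le_log_factorial_stirling hn.ne'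
    have h2 : 0 ≤ Real.log n := Real.log_natCast_nonneg n
    have h3 : 0 ≤ Real.log (2 * Real.pi) := Real.log_nonneg (by linarith [Real.pi_gt_three])
    linarith
  have h2 : Real.log (n ! : ℕ) ≤ n * ∑ p ∈ primesLE n,
      (Real.log p / p + 4 * ((p : ℝ) ^ (3 / 2 : ℝ))⁻¹) := by
    rw [log_factorial_eq_sum_primesLE, Finset.mul_sum]
    refine Finset.sum_le_sum fun p hp ↦ ?_
    have hpp := prime_of_mem_primesLE hp
    have hp2 := hpp.two_le
    have hlog : 0 ≤ Real.log p := Real.log_natCast_nonneg p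
    have hfac : ((n !).factorization p : ℝ) ≤ n / ((p : ℝ) - 1) := by
      calc ((n !).factorization p : ℝ) ≤ (n / (p - 1) : ℕ) := by
            exact_mod_cast factorization_factorial_le_div_pred hpp n
        _ ≤ (n : ℝ) / (p - 1 : ℕ) := Nat.cast_div_le
        _ = _ := by rw [Nat.cast_sub (by omega), Nat.cast_one]
    calc ((n !).factorization p : ℝ) * Real.log p ≤ n / ((p : ℝ) - 1) * Real.log p := by gcongr
      _ = n * (Real.log p / (p - 1)) := by ring
      _ ≤ _ := by gcongr; exact log_div_pred_le hp2
  rw [Finset.sum_add_distrib] at h2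
  have h3 := hsum.sum_le_tsum (primesLE n) (fun p _ ↦ by positivity)
  have h4 : (n : ℝ) * (Real.log n - 1) ≤ n * (∑ p ∈ primesLE n, Real.log p / p +
      ∑ p ∈ primesLE n, 4 * ((p : ℝ) ^ (3 / 2 : ℝ))⁻¹) := by linarith
  have h5 := le_of_mul_le_mul_left h4 hn'
  linarith

theorem exists_div_le_theta_sub_theta_div :
    ∃ K : ℕ, 0 < K ∧ ∀ n : ℕ, K ≤ n → (n : ℝ) / 16 ≤ θ n - θ (n / K : ℕ) := by
  have hev : ∀ᶠ x : ℝ in Filter.atTop, Real.log x ≤ (1 / 64) * x ^ (1 / 2 : ℝ) := by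
    filter_upwards [(isLittleO_log_rpow_atTop (r := 1 / 2) (by norm_num)).bound
      (show (0 : ℝ) < 1 / 64 by norm_num), Filter.eventually_ge_atTop 1] with x hx hx1
    have hpow : 0 ≤ x ^ (1 / 2 : ℝ) := by positivity
    rwa [Real.norm_of_nonneg (Real.log_nonneg hx1), Real.norm_of_nonneg hpow] at hx
  obtain ⟨x₀, hx₀⟩ := Filter.eventually_atTop.1 hev
  refine ⟨max 6 ⌈x₀⌉₊, by positivity, fun n hn ↦ ?_⟩
  have hn6 : 6 ≤ n := (le_max_left _ _).trans hn
  have hn6' : (6 : ℝ) ≤ n := by exact_mod_cast hn6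
  have hxn : x₀ ≤ n := Nat.ceil_le.1 ((le_max_right _ _).trans hn)
  have hlog := hx₀ n hxn
  rw [← Real.sqrt_eq_rpow] at hlog
  have hsq : √(n : ℝ) * √(n : ℝ) = n := Real.mul_self_sqrt (by positivity)
  have hsq0 : 0 ≤ √(n : ℝ) := by positivity
  have hlog1 : Real.log (n + 1) ≤ n / 8 := by
    have h1 := hx₀ (n + 1) (by linarith)
    rw [← Real.sqrt_eq_rpow] at h1
    have h2 : √((n : ℝ) + 1) ≤ n + 1 := Real.sqrt_le_iff.2 ⟨by linarith, by nlinarith⟩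
    linarith
  have htheta := theta_ge n
  have hprod : √(n : ℝ) * Real.log n ≤ n / 64 := by
    calc √(n : ℝ) * Real.log n ≤ √(n : ℝ) * (1 / 64 * √(n : ℝ)) := by gcongr
      _ = n / 64 := by linear_combination hsq / 64
  have hup := theta_le_log4_mul_x (x := (n / max 6 ⌈x₀⌉₊ : ℕ)) (by positivity)
  have hdiv : ((n / max 6 ⌈x₀⌉₊ : ℕ) : ℝ) ≤ n / 6 := by
    calc ((n / max 6 ⌈x₀⌉₊ : ℕ) : ℝ) ≤ (n / 6 : ℕ) := by
          exact_mod_cast Nat.div_le_div_left (le_max_left _ _) (by norm_num)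
      _ ≤ n / 6 := by exact_mod_cast Nat.cast_div_le (m := n) (n := 6) (α := ℝ)
  have hlog4 : Real.log 4 = 2 * Real.log 2 := by
    rw [show (4 : ℝ) = 2 ^ 2 by norm_num, Real.log_pow]; norm_num
  have hl2 := Real.log_two_gt_d9
  have hup' : θ (n / max 6 ⌈x₀⌉₊ : ℕ) ≤ 2 * Real.log 2 * (n / 6) := by
    rw [hlog4] at hup
    refine hup.trans ?_
    gcongr
  have hl2n : (0.6 : ℝ) * n ≤ Real.log 2 * n := by gcongr; linarith
  linarith

/-- The integers in `{1, …, n}` with no prime factor smaller than `k`. -/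
def roughUpTo (k n : ℕ) : Finset ℕ := {d ∈ Icc 1 n | d.Coprime (k - 1)!}

theorem mem_roughUpTo {k n d : ℕ} :
    d ∈ roughUpTo k n ↔ (1 ≤ d ∧ d ≤ n) ∧ d.Coprime (k - 1)! := by
  simp [roughUpTo]

theorem mul_eq_mul_of_coprime_factorial {k t t' d d' : ℕ} (ht : 0 < t) (htk : t < k)
    (ht' : 0 < t') (htk' : t' < k) (hd : d.Coprime (k - 1)!) (hd' : d'.Coprime (k - 1)!)
    (h : t * d = t' * d') : t = t' ∧ d = d' := by
  have h1 : t.Coprime d' := (hd'.coprime_dvd_right (dvd_factorial ht (by omega))).symm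
  have h2 : t'.Coprime d := (hd.coprime_dvd_right (dvd_factorial ht' (by omega))).symm
  have h3 : t = t' := Nat.dvd_antisymm (h1.dvd_of_dvd_mul_right (Dvd.intro _ h))
    (h2.dvd_of_dvd_mul_right (Dvd.intro _ h.symm))
  subst h3
  exact ⟨rfl, Nat.eq_of_mul_eq_mul_left ht h⟩

theorem sum_log_mul_card_roughUpTo_div_le (k n : ℕ) :
    ∑ p ∈ primesLE n with k < p, Real.log p * #(roughUpTo k (n / p)) ≤
      #(roughUpTo k n) * Real.log n := by
  have h1 : ∀ r ∈ roughUpTo k n,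
      ∑ p ∈ primesLE n with k < p, (if p ∣ r then Real.log p else 0) ≤ Real.log n := by
    intro r hr
    obtain ⟨⟨hr1, hrn⟩, -⟩ := mem_roughUpTo.1 hr
    calc ∑ p ∈ primesLE n with k < p, (if p ∣ r then Real.log p else 0)
        = ∑ p ∈ primesLE n with k < p ∧ p ∣ r, Real.log p := by
          rw [← Finset.sum_filter, Finset.filter_filter]
      _ ≤ ∑ p ∈ r.primeFactors, Real.log p := by
          refine Finset.sum_le_sum_of_subset_of_nonneg (fun p hp ↦ ?_)
            fun p _ _ ↦ Real.log_natCast_nonneg p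
          rw [Finset.mem_filter] at hp
          exact Nat.mem_primeFactors.2 ⟨prime_of_mem_primesLE hp.1, hp.2.2, by omega⟩
      _ = Real.log (∏ p ∈ r.primeFactors, p : ℕ) := by
          rw [Nat.cast_prod, Real.log_prod]
          intro p hp
          exact_mod_cast (Nat.prime_of_mem_primeFactors hp).ne_zero
      _ ≤ Real.log n := by
          refine Real.log_le_log ?_ ?_
          · exact_mod_cast Nat.pos_of_dvd_of_pos (Nat.prod_primeFactors_dvd r) hr1
          · exact_mod_cast (Nat.le_of_dvd hr1 (Nat.prod_primeFactors_dvd r)).trans hrn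
  calc ∑ p ∈ primesLE n with k < p, Real.log p * #(roughUpTo k (n / p))
      ≤ ∑ p ∈ primesLE n with k < p, ∑ r ∈ roughUpTo k n,
          (if p ∣ r then Real.log p else 0) := by
        refine Finset.sum_le_sum fun p hp ↦ ?_
        rw [Finset.mem_filter] at hp
        have hpp := prime_of_mem_primesLE hp.1
        have hlog : 0 ≤ Real.log p := Real.log_natCast_nonneg p
        rw [← Finset.sum_filter, Finset.sum_const, nsmul_eq_mul, mul_comm]
        refine mul_le_mul_of_nonneg_right ?_ hlog
        norm_cast
        refine Finset.card_le_card_of_injOn (fun s ↦ p * s) (fun s hs ↦ ?_)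
          (fun a _ b _ h ↦ Nat.eq_of_mul_eq_mul_left hpp.pos h)
        obtain ⟨⟨hs1, hsn⟩, hs⟩ := mem_roughUpTo.1 hs
        rw [Finset.mem_coe, Finset.mem_filter, mem_roughUpTo]
        exact ⟨⟨⟨Nat.mul_pos hpp.pos hs1, (Nat.mul_le_mul_left p hsn).trans (Nat.mul_div_le n p)⟩,
          (hpp.coprime_factorial_of_lt (by omega)).mul_left hs⟩, dvd_mul_right _ _⟩
    _ = ∑ r ∈ roughUpTo k n, ∑ p ∈ primesLE n with k < p,
          (if p ∣ r then Real.log p else 0) := Finset.sum_comm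
    _ ≤ ∑ r ∈ roughUpTo k n, Real.log n := Finset.sum_le_sum h1
    _ = _ := by rw [Finset.sum_const, nsmul_eq_mul]

theorem one_le_card_roughUpTo {k n : ℕ} (hn : 1 ≤ n) : 1 ≤ #(roughUpTo k n) :=
  Finset.card_pos.2 ⟨1, mem_roughUpTo.2 ⟨⟨le_rfl, hn⟩, Nat.coprime_one_left _⟩⟩

theorem sum_primesLE_sub_le_sum_filter {f : ℕ → ℝ} (hf : ∀ p, 0 ≤ f p) (k n : ℕ) :
    ∑ p ∈ primesLE n, f p - ∑ p ∈ primesLE k, f p ≤ ∑ p ∈ primesLE n with k < p, f p := by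
  rw [← Finset.sum_filter_add_sum_filter_not (primesLE n) (fun p ↦ k < p)]
  have : ∑ p ∈ primesLE n with ¬ k < p, f p ≤ ∑ p ∈ primesLE k, f p := by
    refine Finset.sum_le_sum_of_subset_of_nonneg (fun p hp ↦ ?_) fun p _ _ ↦ hf p
    rw [Finset.mem_filter, mem_primesLE] at hp
    exact mem_primesLE.2 ⟨by omega, hp.1.2⟩
  linarith

/-- There are at least a constant times `n / log k` integers up to `n` without prime factors
smaller than `k`, provided that `n` is at least a constant times `k`. -/
theorem exists_card_roughUpTo_ge :
    ∃ K : ℕ, 0 < K ∧ ∃ c : ℝ, 0 < c ∧ ∀ k : ℕ, 2 ≤ k → ∀ n : ℕ, K * k ≤ n →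
      c * (n + 1) / Real.log k ≤ #(roughUpTo k n) := by
  obtain ⟨K, hK, hcheb⟩ := exists_div_le_theta_sub_theta_div
  obtain ⟨M, hM, hmer⟩ := exists_log_sub_le_sum_log_div_primesLE
  have hK' : (1 : ℝ) ≤ K := by exact_mod_cast hK
  have hlogK : 0 ≤ Real.log K := Real.log_natCast_nonneg K
  set B : ℝ := Real.log K + Real.log 2 + M + Real.log 4 with hB
  have hB0 : 0 ≤ B := by positivity
  set c : ℝ := 1 / (16 * (4 + 2 * B)) with hc
  have hc0 : 0 < c := by positivity
  have hcB : c * (4 + 2 * B) = 1 / 16 := by rw [hc]; field_simp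
  refine ⟨K, hK, c, hc0, fun k hk n ↦ ?_⟩
  have hk' : (2 : ℝ) ≤ k := by exact_mod_cast hk
  have hL : 1 / 2 ≤ Real.log k := by
    have := Real.log_le_log (by norm_num) hk'
    linarith [Real.log_two_gt_d9]
  set L := Real.log k with hLdef
  have hL0 : 0 < L := by linarith
  induction n using Nat.strong_induction_on with
  | _ n ih =>
  intro hn
  have hKk : 0 < K * k := by positivity
  have hkn : k ≤ n / K := (Nat.le_div_iff_mul_le hK).2 (by rwa [mul_comm])
  have hn2 : 2 ≤ n := hk.trans (hkn.trans (Nat.div_le_self _ _))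
  have hn2' : (2 : ℝ) ≤ n := by exact_mod_cast hn2
  have hlogn : 0 < Real.log n := Real.log_pos (by linarith)
  set y := n / (K * k) with hy
  have hy1 : 1 ≤ y := (Nat.one_le_div_iff hKk).2 hn
  have hyK : y ≤ n / K := Nat.div_le_div_left (Nat.le_mul_of_pos_right _ (by omega)) hK
  have hynn : y ≤ n := Nat.div_le_self _ _
  have hsmall : c * n / L * (Real.log n - 2 * L - B) ≤
      ∑ p ∈ primesLE y with k < p, Real.log p * #(roughUpTo k (n / p)) := by
    have hylog : Real.log n - Real.log K - L - Real.log 2 ≤ Real.log y := by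
      have h1 : n ≤ K * k * (2 * y) := by
        have := Nat.lt_mul_div_succ n hKk
        rw [← hy] at this
        nlinarith
      have h2 : (n : ℝ) ≤ K * k * (2 * y) := by exact_mod_cast h1
      have h3 := Real.log_le_log (by linarith) h2
      have hy0 : (y : ℝ) ≠ 0 := by positivity
      rw [Real.log_mul (by positivity) (by positivity), Real.log_mul (by positivity) (by positivity),
        Real.log_mul (by norm_num) hy0] at h3
      linarith
    have hS : Real.log n - 2 * L - B ≤ ∑ p ∈ primesLE y with k < p, Real.log p / p := by
      have h1 := sum_primesLE_sub_le_sum_filter (f := fun p ↦ Real.log p / p)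
        (fun p ↦ div_nonneg (Real.log_natCast_nonneg p) (by positivity)) k y
      have h2 := hmer y hy1
      have h3 := sum_log_div_primesLE_le (n := k) (by omega)
      linarith
    calc c * n / L * (Real.log n - 2 * L - B)
        ≤ c * n / L * ∑ p ∈ primesLE y with k < p, Real.log p / p := by gcongr
      _ = ∑ p ∈ primesLE y with k < p, Real.log p * (c * (n / p) / L) := by
          rw [Finset.mul_sum]
          exact Finset.sum_congr rfl fun p _ ↦ by ring
      _ ≤ _ := by
          refine Finset.sum_le_sum fun p hp ↦ ?_
          rw [Finset.mem_filter, mem_primesLE] at hp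
          obtain ⟨⟨hpy, hpp⟩, -⟩ := hp
          have hlog : 0 ≤ Real.log p := Real.log_natCast_nonneg p
          have hKn : K * k ≤ n / p := by
            rw [Nat.le_div_iff_mul_le hpp.pos, mul_comm]
            exact (Nat.le_div_iff_mul_le hKk).1 hpy
          have hrec := ih (n / p) (Nat.div_lt_self (by omega) hpp.one_lt) hKn
          have hfl : (n : ℝ) / p ≤ (n / p : ℕ) + 1 := by
            rw [← Nat.floor_div_eq_div (K := ℝ)]
            exact (Nat.lt_floor_add_one _).le
          refine mul_le_mul_of_nonneg_left (le_trans ?_ hrec) hlog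
          gcongr
  have hlarge : (n : ℝ) / 16 ≤
      ∑ p ∈ primesLE n with n / K < p, Real.log p * #(roughUpTo k (n / p)) := by
    have hKn : K ≤ n := (Nat.le_mul_of_pos_right _ (by omega)).trans hn
    have h1 := hcheb n hKn
    rw [theta_eq_sum_primesLE_log, theta_eq_sum_primesLE_log] at h1
    refine (h1.trans (sum_primesLE_sub_le_sum_filter Real.log_natCast_nonneg _ _)).trans
      (Finset.sum_le_sum fun p hp ↦ ?_)
    rw [Finset.mem_filter, mem_primesLE] at hp
    obtain ⟨⟨hpn, hpp⟩, -⟩ := hp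
    have : (1 : ℝ) ≤ #(roughUpTo k (n / p)) := by
      exact_mod_cast one_le_card_roughUpTo ((Nat.one_le_div_iff hpp.pos).2 hpn)
    exact le_mul_of_one_le_right (Real.log_natCast_nonneg p) this
  have htotal : ∑ p ∈ primesLE y with k < p, Real.log p * (#(roughUpTo k (n / p)) : ℝ) +
      ∑ p ∈ primesLE n with n / K < p, Real.log p * (#(roughUpTo k (n / p)) : ℝ) ≤
      ∑ p ∈ primesLE n with k < p, Real.log p * (#(roughUpTo k (n / p)) : ℝ) := by
    rw [← Finset.sum_union]
    · refine Finset.sum_le_sum_of_subset_of_nonneg (fun p hp ↦ ?_)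
        fun p _ _ ↦ mul_nonneg (Real.log_natCast_nonneg p) (by positivity)
      simp only [Finset.mem_union, Finset.mem_filter, mem_primesLE] at hp ⊢
      rcases hp with ⟨⟨h1, h2⟩, h3⟩ | ⟨⟨h1, h2⟩, h3⟩
      · exact ⟨⟨by omega, h2⟩, h3⟩
      · exact ⟨⟨h1, h2⟩, by omega⟩
    · rw [Finset.disjoint_left]
      intro p hp hp'
      simp only [Finset.mem_filter, mem_primesLE] at hp hp'
      omega
  have hweighted := sum_log_mul_card_roughUpTo_div_le k n
  have hloss : c / L * (2 * n * L + (n * B + Real.log n)) ≤ n / 16 := by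
    have hln : Real.log n ≤ n := (Real.log_le_sub_one_of_pos (by linarith)).trans (by linarith)
    have h1 : n * B + Real.log n ≤ 2 * L * (n * B + n) := by
      have : 0 ≤ n * B + n := by positivity
      nlinarith
    calc c / L * (2 * n * L + (n * B + Real.log n))
        ≤ c / L * (2 * n * L + 2 * L * (n * B + n)) := by gcongr
      _ = n * (c * (4 + 2 * B)) := by field_simp; ring
      _ = n / 16 := by rw [hcB]; ring
  have hfinal : c * (n + 1) / L * Real.log n ≤ #(roughUpTo k n) * Real.log n := by
    have h1 : c * (n + 1) / L * Real.log n = c * n / L * (Real.log n - 2 * L - B) +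
        c / L * (2 * n * L + (n * B + Real.log n)) := by ring
    linarith
  exact le_of_mul_le_mul_right hfinal hlogn

theorem card_monochromatic_pairs_le {C : Type*} [DecidableEq C] {χ : ℕ → C} {m n : ℕ}
    (hχ : ∀ col : C, {i : ℕ | i ∈ Finset.Icc 1 n ∧ χ i = col}.ncard ≤ m) :
    #{q ∈ Icc 1 n ×ˢ Icc 1 n | χ q.2 = χ q.1} ≤ n * m := by
  have h : ∀ x ∈ Icc 1 n, #{y ∈ Icc 1 n | χ y = χ x} ≤ m := fun x _ ↦ by
    rw [← Set.ncard_coe_finset, Finset.coe_filter]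
    exact hχ (χ x)
  calc #{q ∈ Icc 1 n ×ˢ Icc 1 n | χ q.2 = χ q.1}
      = ∑ x ∈ Icc 1 n, #{y ∈ Icc 1 n | χ y = χ x} := by
        simp only [Finset.card_filter, Finset.sum_product]
    _ ≤ #(Icc 1 n) • m := Finset.sum_le_card_nsmul _ _ _ h
    _ = n * m := by simp

/-- Without rainbow progressions, sending a progression whose common difference has no prime factor
smaller than `k` to a monochromatic pair in it, with the index of the first point of the pair,
is injective. -/
theorem card_roughUpTo_le_of_no_rainbow {C : Type*} {χ : ℕ → C} {k m n : ℕ} (hk : 2 ≤ k)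
    (hn : 0 < n)
    (hχ : ∀ col : C, {i : ℕ | i ∈ Finset.Icc 1 n ∧ χ i = col}.ncard ≤ m)
    (hno : ¬ ∃ a d : ℕ, 1 ≤ a ∧ 1 ≤ d ∧ a + (k - 1) * d ≤ n ∧
      ∀ i < k, ∀ j < k, i ≠ j → χ (a + i * d) ≠ χ (a + j * d)) :
    #(roughUpTo k (n / (2 * k))) ≤ 2 * k * m := by
  classical
  set D := roughUpTo k (n / (2 * k)) with hD
  have hfit : ∀ q ∈ Icc 1 (n - n / 2) ×ˢ D, 1 ≤ q.1 ∧ 1 ≤ q.2 ∧ q.1 + (k - 1) * q.2 ≤ n := by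
    rintro ⟨a, d⟩ hq
    rw [Finset.mem_product, Finset.mem_Icc, hD, mem_roughUpTo] at hq
    obtain ⟨⟨ha1, han⟩, ⟨hd1, hdn⟩, -⟩ := hq
    have h1 : d * (2 * k) ≤ n := (Nat.le_div_iff_mul_le (by omega)).1 hdn
    have h2 : (k - 1) * d ≤ n / 2 := by
      rw [Nat.le_div_iff_mul_le (by norm_num)]
      calc (k - 1) * d * 2 ≤ k * d * 2 := by gcongr; omega
        _ = d * (2 * k) := by ring
        _ ≤ n := h1
    dsimp only at *
    exact ⟨ha1, hd1, by omega⟩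
  have hpair : ∀ q ∈ Icc 1 (n - n / 2) ×ˢ D, ∃ i j : ℕ, i < j ∧ j < k ∧
      χ (q.1 + j * q.2) = χ (q.1 + i * q.2) := by
    intro q hq
    obtain ⟨h1, h2, h3⟩ := hfit q hq
    by_contra! hcon
    refine hno ⟨q.1, q.2, h1, h2, h3, fun i hi j hj hij ↦ ?_⟩
    rcases hij.lt_or_gt with h | h
    · exact (hcon i j h hj).symm
    · exact hcon j i h hi
  choose! i j hij hjk heq using hpair
  have hcard : #(Icc 1 (n - n / 2) ×ˢ D) ≤
      #(range k ×ˢ {q ∈ Icc 1 n ×ˢ Icc 1 n | χ q.2 = χ q.1}) := by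
    refine Finset.card_le_card_of_injOn
      (fun q ↦ (i q, (q.1 + i q * q.2, q.1 + j q * q.2))) (fun q hq ↦ ?_) ?_
    · obtain ⟨h1, h2, h3⟩ := hfit q hq
      have hi := hij q hq
      have hj := hjk q hq
      have h4 : i q * q.2 ≤ (k - 1) * q.2 := by gcongr; omega
      have h5 : j q * q.2 ≤ (k - 1) * q.2 := by gcongr; omega
      simp only [Finset.coe_product, Set.mem_prod, Finset.mem_coe, Finset.mem_range,
        Finset.mem_filter, Finset.mem_product, Finset.mem_Icc]
      exact ⟨by omega, ⟨⟨by omega, by omega⟩, by omega, by omega⟩, heq q hq⟩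
    · intro q hq q' hq' h
      simp only [Prod.mk.injEq] at h
      obtain ⟨hi, hx, hy⟩ := h
      have hlt := hij q hq
      have hlt' := hij q' hq'
      have hj := hjk q hq
      have hj' := hjk q' hq'
      have hd := (mem_roughUpTo.1 (Finset.mem_product.1 hq).2).2
      have hd' := (mem_roughUpTo.1 (Finset.mem_product.1 hq').2).2
      have hdiff : (j q - i q) * q.2 = (j q' - i q') * q'.2 := by
        have h1 : i q * q.2 ≤ j q * q.2 := by gcongr
        have h2 : i q' * q'.2 ≤ j q' * q'.2 := by gcongr
        rw [Nat.sub_mul, Nat.sub_mul]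
        omega
      obtain ⟨-, hdd⟩ := mul_eq_mul_of_coprime_factorial (k := k) (by omega) (by omega) (by omega)
        (by omega) hd hd' hdiff
      rw [hi, hdd] at hx
      exact Prod.ext (by omega) hdd
  rw [Finset.card_product, Finset.card_product, Nat.card_Icc, Finset.card_range] at hcard
  have hmono := card_monochromatic_pairs_le hχ
  refine Nat.le_of_mul_le_mul_left (?_ : n * #D ≤ n * (2 * k * m)) hn
  calc n * #D ≤ 2 * (n - n / 2 + 1 - 1) * #D := by gcongr; omega
    _ = 2 * ((n - n / 2 + 1 - 1) * #D) := by ring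
    _ ≤ 2 * (k * (n * m)) :=
        Nat.mul_le_mul_left 2 (hcard.trans (Nat.mul_le_mul_left k hmono))
    _ = n * (2 * k * m) := by ring

/-- Sub-Ramsey numbers: there is a constant `c > 0` such that for every `k ≥ 2`, every
`m ≥ 1` and every `n ≥ c m k² log k`, every coloring of `{1, …, n}` in which no color is
used more than `m` times contains a rainbow `k`-term arithmetic progression; that is,
`sr(m,k) ≤ c m k² log k`. -/
theorem sub_ramsey_upper_bound :
    ∃ c : ℝ, 0 < c ∧
      ∀ k : ℕ, 2 ≤ k → ∀ m : ℕ, 0 < m → ∀ n : ℕ,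
        c * m * k ^ 2 * Real.log k ≤ (n : ℝ) →
        ∀ (C : Type) (χ : ℕ → C),
          (∀ col : C, {i : ℕ | i ∈ Finset.Icc 1 n ∧ χ i = col}.ncard ≤ m) →
          ∃ a d : ℕ, 1 ≤ a ∧ 1 ≤ d ∧ a + (k - 1) * d ≤ n ∧
            ∀ i < k, ∀ j < k, i ≠ j → χ (a + i * d) ≠ χ (a + j * d) := by
  obtain ⟨K, hK, c₀, hc₀, hrough⟩ := exists_card_roughUpTo_ge
  refine ⟨5 / c₀ + 4 * K, by positivity, fun k hk m hm n hn C χ hχ ↦ ?_⟩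
  by_contra hno
  have hk' : (2 : ℝ) ≤ k := by exact_mod_cast hk
  have hm' : (1 : ℝ) ≤ m := by exact_mod_cast hm
  have hK' : (0 : ℝ) < K := by exact_mod_cast hK
  have hL : 1 / 2 ≤ Real.log k := by
    have := Real.log_le_log (by norm_num) hk'
    linarith [Real.log_two_gt_d9]
  have hL0 : 0 < Real.log k := by linarith
  have hlong : K * k ≤ n / (2 * k) := by
    rw [Nat.le_div_iff_mul_le (by omega)]
    have : (K : ℝ) * k * (2 * k) ≤ n := by
      calc (K : ℝ) * k * (2 * k) = 4 * K * 1 * k ^ 2 * (1 / 2) := by ring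
        _ ≤ (5 / c₀ + 4 * K) * m * k ^ 2 * Real.log k := by
            gcongr
            exact le_add_of_nonneg_left (by positivity)
        _ ≤ n := hn
    exact_mod_cast this
  have hmany : 5 / c₀ * m * k ^ 2 * Real.log k ≤ n := by
    refine le_trans ?_ hn
    gcongr
    exact le_add_of_nonneg_right (by positivity)
  have hnpos : 0 < n := by
    have : (0 : ℝ) < n := lt_of_lt_of_le (by positivity) hmany
    exact_mod_cast this
  have hlower := hrough k hk _ hlong
  have hupper : (#(roughUpTo k (n / (2 * k))) : ℝ) ≤ 2 * k * m := by
    exact_mod_cast card_roughUpTo_le_of_no_rainbow hk hnpos hχ hno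
  have hfloor : (n : ℝ) / (2 * k) ≤ (n / (2 * k) : ℕ) + 1 := by
    have := (Nat.lt_floor_add_one ((n : ℝ) / (2 * k : ℕ))).le
    rw [Nat.floor_div_eq_div] at this
    exact_mod_cast this
  have hchain : 5 / 2 * (k * m : ℝ) ≤ 2 * k * m := by
    calc 5 / 2 * (k * m : ℝ)
        = c₀ * (5 / c₀ * m * k ^ 2 * Real.log k / (2 * k)) / Real.log k := by field_simp
      _ ≤ c₀ * (n / (2 * k)) / Real.log k := by gcongr
      _ ≤ c₀ * ((n / (2 * k) : ℕ) + 1) / Real.log k := by gcongr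
      _ ≤ 2 * k * m := hlower.trans hupper
  have : (0 : ℝ) < k * m := by positivity
  linarith
end

section
/- For each integer r ≥ 2 and each η > 0 there exists δ > 0 such that the following holds for every positive integer n. Let G be a graph on n vertices with at least t_r(n) edges. Then at least one of the following holds: (i) G is isomorphic to the Turán graph T_{n,r}; (ii) G contains at least δ n^{r+1} copies of K_{r+1}; or (iii) G has an edge contained in at least (1−η)·((r−1)/r²)^{r−1}·n^{r−1} copies of K_{r+1}. -/
open Finset

universe u

theorem one_sub_inv_pow_le_rpow {r : ℕ} (hr : 2 ≤ r) {t : ℝ} (htr : 1 / (r : ℝ) < t)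
    (ht : t < 1) :
    (1 - 1 / (r : ℝ)) ^ (r - 1) ≤ (1 - t) ^ ((1 - t) / t) := by
  have hr' : (2 : ℝ) ≤ r := by exact_mod_cast hr
  have ht₀ : 0 < t := htr.trans' (by positivity)
  set s := (1 - t) / t with hs
  set p := (r : ℝ) - 1 with hp
  have hp₀ : 0 < p := by linarith
  have hs₀ : 0 < s := div_pos (by linarith) ht₀
  have hsp : s ≤ p := by
    rw [div_le_iff₀ ht₀]
    rw [div_lt_iff₀ (by linarith)] at htr
    linarith
  have h₁ : (1 + 1 / s) ^ (s / p) ≤ 1 + 1 / p := by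
    have := rpow_one_add_le_one_add_mul_self (s := 1 / s) (p := s / p)
      (by have : 0 < 1 / s := by positivity
          linarith) (by positivity) (by rwa [div_le_one hp₀])
    refine this.trans_eq ?_
    field_simp
  have h₂ : (1 + 1 / s) ^ s ≤ (1 + 1 / p) ^ p := by
    have := Real.rpow_le_rpow (by positivity) h₁ hp₀.le
    rwa [← Real.rpow_mul (by positivity), div_mul_cancel₀ _ hp₀.ne'] at this
  have h₃ : 1 - t = (1 + 1 / s)⁻¹ := by
    have : 1 - t ≠ 0 := by linarith
    rw [hs]; field_simp; ring
  have h₄ : 1 - 1 / (r : ℝ) = (1 + 1 / p)⁻¹ := by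
    have : (r : ℝ) ≠ 0 := by linarith
    rw [inv_eq_one_div, eq_div_iff (by positivity)]
    field_simp; rw [hp]; ring
  have h₅ : ((r - 1 : ℕ) : ℝ) = p := by rw [Nat.cast_sub (by lia)]; simp [hp]
  rw [← Real.rpow_natCast, h₅, h₃, h₄, Real.inv_rpow (by positivity), Real.inv_rpow (by positivity)]
  exact inv_anti₀ (by positivity) h₂

/-- A lower bound for a product of `1 - y j` over numbers with bounded sum, omitting the largest. -/
theorem mul_rpow_le_prod_one_sub {ι : Type*} [DecidableEq ι] {Q : Finset ι} (hQ : 2 ≤ #Q)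
    {q : ι} (hq : q ∈ Q) {y : ι → ℝ} (hy : ∀ j ∈ Q, 0 ≤ y j) (hyq : ∀ j ∈ Q, y j ≤ y q)
    {g κ : ℝ} (hg : 0 < g) (hgq : y q ≤ 1 - g) (hκ : 0 ≤ κ) (hsum : ∑ j ∈ Q, y j ≤ 1 + κ) :
    (1 - 1 / (#Q : ℝ)) ^ (#Q - 1) * g ^ (κ * #Q) ≤ ∏ j ∈ Q.erase q, (1 - y j) := by
  set r := #Q with hr
  have hr' : (2 : ℝ) ≤ r := by exact_mod_cast hQ
  have hr₁ : 1 / (r : ℝ) ≤ 1 := by rw [div_le_one (by linarith)]; linarith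
  have hcard : #(Q.erase q) = r - 1 := card_erase_of_mem hq
  have hg₁ : g ≤ 1 := by linarith [hy q hq]
  obtain ht | ht := le_or_gt (y q) (1 / (r : ℝ))
  · calc (1 - 1 / (r : ℝ)) ^ (r - 1) * g ^ (κ * r) ≤ (1 - 1 / (r : ℝ)) ^ (r - 1) * 1 := by
          refine mul_le_mul_of_nonneg_left ?_ (pow_nonneg (by linarith) _)
          exact Real.rpow_le_one hg.le hg₁ (by positivity)
      _ = ∏ j ∈ Q.erase q, (1 - 1 / (r : ℝ)) := by rw [prod_const, hcard, mul_one]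
      _ ≤ _ := prod_le_prod (fun _ _ ↦ by linarith) fun j hj ↦ by
          linarith [hyq j (mem_of_mem_erase hj)]
  · have ht₀ : 0 < y q := ht.trans' (by positivity)
    have h₁ : 0 < 1 - y q := by linarith
    calc (1 - 1 / (r : ℝ)) ^ (r - 1) * g ^ (κ * r)
        ≤ (1 - y q) ^ ((1 - y q) / y q) * (1 - y q) ^ (κ * r) := by
          gcongr
          · exact one_sub_inv_pow_le_rpow hQ ht (by linarith)
          · linarith
      _ = (1 - y q) ^ ((1 - y q) / y q + κ * r) := (Real.rpow_add h₁ _ _).symm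
      _ ≤ (1 - y q) ^ (∑ j ∈ Q.erase q, y j / y q) := by
          refine Real.rpow_le_rpow_of_exponent_ge h₁ (by linarith) ?_
          rw [← sum_div, sum_erase_eq_sub hq, div_le_iff₀ ht₀, add_mul,
            div_mul_cancel₀ _ ht₀.ne']
          have : 1 ≤ r * y q := by
            rw [div_lt_iff₀ (by linarith)] at ht
            linarith
          nlinarith
      _ = ∏ j ∈ Q.erase q, (1 - y q) ^ (y j / y q) := Real.rpow_sum_of_pos h₁ _ _
      _ ≤ _ := prod_le_prod (fun _ _ ↦ by positivity) fun j hj ↦ by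
          have hj := mem_of_mem_erase hj
          have := rpow_one_add_le_one_add_mul_self (s := -y q) (p := y j / y q)
            (by linarith) (div_nonneg (hy j hj) ht₀.le) ((div_le_one ht₀).2 (hyq j hj))
          rw [mul_neg, div_mul_cancel₀ _ ht₀.ne'] at this
          exact this

namespace SimpleGraph

/-- Deleting vertices of small degree: some induced subgraph has all its degrees at least the
increment of `f`, and its number of edges does not decrease relative to `f`. -/
theorem exists_embedding_le_degree {V : Type u} [Fintype V] [DecidableEq V]
    (G : SimpleGraph V) [DecidableRel G.Adj] (f : ℕ → ℝ) :
    ∃ (W : Type u) (_ : Fintype W) (_ : DecidableEq W) (H : SimpleGraph W)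
      (_ : DecidableRel H.Adj), Nonempty (H ↪g G) ∧
      (#G.edgeFinset : ℝ) - f (Fintype.card V) ≤ #H.edgeFinset - f (Fintype.card W) ∧
      ∀ v, f (Fintype.card W) - f (Fintype.card W - 1) ≤ H.degree v := by
  induction hn : Fintype.card V generalizing V with
  | zero =>
    have := Fintype.card_eq_zero_iff.1 hn
    exact ⟨V, inferInstance, inferInstance, G, inferInstance, ⟨Embedding.refl⟩, by rw [hn],
      fun v ↦ isEmptyElim v⟩
  | succ n ih =>
    by_cases h : ∀ v, f (n + 1) - f n ≤ G.degree v
    · exact ⟨V, inferInstance, inferInstance, G, inferInstance, ⟨Embedding.refl⟩, by rw [hn],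
        fun v ↦ by simpa [hn] using h v⟩
    · push Not at h
      obtain ⟨v, hv⟩ := h
      have hcard : Fintype.card ({v}ᶜ : Set V) = n := by
        rw [Fintype.card_compl_set, hn]; simp
      obtain ⟨W, i₁, i₂, H, i₃, ⟨φ⟩, h₁, h₂⟩ := ih (G.induce {v}ᶜ) hcard
      refine ⟨W, i₁, i₂, H, i₃, ⟨(Embedding.induce _).comp φ⟩, h₁.trans' ?_, h₂⟩
      rw [card_edgeFinset_induce_compl_singleton, card_edgeFinset_deleteIncidenceSet,
        Nat.cast_sub (G.degree_le_card_edgeFinset v)]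
      linarith

theorem IsNClique.map_embedding {V W : Type*} {G : SimpleGraph V} {H : SimpleGraph W}
    (φ : H ↪g G) {k : ℕ} {s : Finset W}
    (hs : H.IsNClique k s) :
    G.IsNClique k (s.map φ.toEmbedding) := by
  refine ⟨?_, by rw [card_map, hs.card_eq]⟩
  rw [coe_map]
  rintro _ ⟨a, ha, rfl⟩ _ ⟨b, hb, rfl⟩ hab
  exact φ.map_adj_iff.2 (hs.isClique ha hb fun h ↦ hab (by rw [h]))

section Embedding

variable {V W : Type*} [Fintype V] [DecidableEq V] [Fintype W] [DecidableEq W]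
  {G : SimpleGraph V} [DecidableRel G.Adj] {H : SimpleGraph W} [DecidableRel H.Adj]

theorem card_cliqueFinset_le_of_embedding (φ : H ↪g G) (k : ℕ) :
    #(H.cliqueFinset k) ≤ #(G.cliqueFinset k) := by
  refine card_le_card_of_injOn (Finset.map φ.toEmbedding) (fun s hs ↦ ?_)
    (Finset.map_injective _).injOn
  simp only [mem_coe, mem_cliqueFinset_iff] at hs ⊢
  exact hs.map_embedding φ

theorem card_cliqueFinset_filter_le_of_embedding (φ : H ↪g G) (k : ℕ) (u v : W) :
    #{s ∈ H.cliqueFinset k | u ∈ s ∧ v ∈ s} ≤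
      #{s ∈ G.cliqueFinset k | φ u ∈ s ∧ φ v ∈ s} := by
  refine card_le_card_of_injOn (Finset.map φ.toEmbedding) (fun s hs ↦ ?_)
    (Finset.map_injective _).injOn
  simp only [coe_filter, mem_cliqueFinset_iff, Set.mem_ofPred_eq] at hs ⊢
  exact ⟨hs.1.map_embedding φ, mem_map_of_mem _ hs.2.1, mem_map_of_mem _ hs.2.2⟩

end Embedding

theorem card_not_adj_le {V : Type*} [Fintype V] {G : SimpleGraph V} [DecidableRel G.Adj]
    {x : ℝ} (h : ∀ v, Fintype.card V - x ≤ G.degree v) (q : V) : (#{v | ¬ G.Adj v q} : ℝ) ≤ x := by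
  have h₁ := card_filter_add_card_filter_not (s := (univ : Finset V)) (fun v ↦ G.Adj v q)
  have h₂ : G.degree q = #{v | G.Adj v q} := by
    rw [← card_neighborFinset_eq_degree, neighborFinset_eq_filter]
    simp only [G.adj_comm]
  have h₃ := h q
  rw [card_univ] at h₁
  rw [h₂, ← h₁] at h₃
  push_cast at h₃
  linarith

section Count

variable {V : Type*} [Fintype V] [DecidableEq V] (G : SimpleGraph V) [DecidableRel G.Adj]

theorem sum_card_commonNeighbors_le (k : ℕ) :
    ∑ Q ∈ G.cliqueFinset k, #{v | ∀ q ∈ Q, G.Adj v q} ≤ (k + 1) * #(G.cliqueFinset (k + 1)) := by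
  calc ∑ Q ∈ G.cliqueFinset k, #{v | ∀ q ∈ Q, G.Adj v q}
      ≤ ∑ Q ∈ G.cliqueFinset k, #(bipartiteAbove (· ⊆ ·) (G.cliqueFinset (k + 1)) Q) := by
        refine sum_le_sum fun Q hQ ↦ ?_
        rw [mem_cliqueFinset_iff] at hQ
        refine card_le_card_of_injOn (insert · Q) (fun v hv ↦ ?_) (fun v hv w hw h ↦ ?_)
        · simp only [coe_filter, mem_univ, true_and, Set.mem_ofPred_eq] at hv
          simp only [coe_bipartiteAbove, mem_cliqueFinset_iff, Set.mem_ofPred_eq]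
          exact ⟨hQ.insert hv, subset_insert _ _⟩
        · simp only [coe_filter, mem_univ, true_and, Set.mem_ofPred_eq] at hv hw
          have : v ∈ insert w Q := by rw [← show insert v Q = insert w Q from h]; simp
          exact (mem_insert.1 this).resolve_right fun hvQ ↦ (hv v hvQ).ne rfl
    _ = ∑ K ∈ G.cliqueFinset (k + 1), #(bipartiteBelow (· ⊆ ·) (G.cliqueFinset k) K) :=
        sum_card_bipartiteAbove_eq_sum_card_bipartiteBelow _
    _ ≤ ∑ K ∈ G.cliqueFinset (k + 1), (k + 1) := by
        refine sum_le_sum fun K hK ↦ ?_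
        rw [mem_cliqueFinset_iff] at hK
        calc _ ≤ #(powersetCard k K) := card_le_card fun Q hQ ↦ by
              simp only [mem_bipartiteBelow, mem_cliqueFinset_iff] at hQ
              exact mem_powersetCard.2 ⟨hQ.2, hQ.1.card_eq⟩
          _ = k + 1 := by rw [card_powersetCard, hK.card_eq, Nat.choose_succ_self_right]
    _ = _ := by rw [sum_const, smul_eq_mul, mul_comm]

variable {G}

theorem le_card_commonNeighbors {x : ℝ} (h : ∀ v, Fintype.card V - x ≤ G.degree v)
    (Q : Finset V) : (Fintype.card V : ℝ) - #Q * x ≤ #{v | ∀ q ∈ Q, G.Adj v q} := by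
  have h₁ := card_filter_add_card_filter_not (s := (univ : Finset V)) (fun v ↦ ∀ q ∈ Q, G.Adj v q)
  have h₂ : ({v | ¬ ∀ q ∈ Q, G.Adj v q} : Finset V) ⊆ Q.biUnion fun q ↦ {v | ¬ G.Adj v q} := by
    intro v hv; simpa using hv
  have h₃ : (#{v | ¬ ∀ q ∈ Q, G.Adj v q} : ℝ) ≤ #Q * x := by
    calc (#{v | ¬ ∀ q ∈ Q, G.Adj v q} : ℝ) ≤ ∑ q ∈ Q, (#{v | ¬ G.Adj v q} : ℝ) := by
          exact_mod_cast (card_le_card h₂).trans card_biUnion_le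
      _ ≤ ∑ q ∈ Q, x := sum_le_sum fun q _ ↦ card_not_adj_le h q
      _ = #Q * x := by simp
  rw [card_univ] at h₁
  rw [← h₁]
  push_cast
  linarith

/-- Greedy lower bound for the number of `k`-cliques in a graph with large minimum degree. -/
theorem pow_le_factorial_mul_card_cliqueFinset {x y : ℝ} {k : ℕ} (hx : 0 ≤ x) (hy : 0 ≤ y)
    (h : ∀ v, Fintype.card V - x ≤ G.degree v) (hxy : y + ((k : ℝ) - 1) * x ≤ Fintype.card V) :
    y ^ k ≤ k.factorial * #(G.cliqueFinset k) := by
  suffices ∀ j ≤ k, y ^ j ≤ j.factorial * #(G.cliqueFinset j) from this k le_rfl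
  intro j
  induction j with
  | zero =>
    intro _
    have : (∅ : Finset V) ∈ G.cliqueFinset 0 := by simp
    simpa using card_pos.2 ⟨_, this⟩
  | succ j ih =>
    intro hj
    have h₁ : #(G.cliqueFinset j) * y ≤ ((j + 1) * #(G.cliqueFinset (j + 1)) : ℝ) := by
      calc #(G.cliqueFinset j) * y = ∑ Q ∈ G.cliqueFinset j, y := by simp
        _ ≤ ∑ Q ∈ G.cliqueFinset j, (#{v | ∀ q ∈ Q, G.Adj v q} : ℝ) := by
          refine sum_le_sum fun Q hQ ↦ (le_card_commonNeighbors h Q).trans' ?_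
          rw [mem_cliqueFinset_iff] at hQ
          rw [hQ.card_eq]
          have : (j : ℝ) ≤ k - 1 := by
            have : ((j + 1 : ℕ) : ℝ) ≤ k := by exact_mod_cast hj
            push_cast at this; linarith
          nlinarith
        _ ≤ _ := by exact_mod_cast G.sum_card_commonNeighbors_le j
    calc y ^ (j + 1) = y ^ j * y := pow_succ _ _
      _ ≤ j.factorial * #(G.cliqueFinset j) * y := by gcongr; exact ih (by lia)
      _ = j.factorial * (#(G.cliqueFinset j) * y) := by ring
      _ ≤ j.factorial * ((j + 1) * #(G.cliqueFinset (j + 1))) := by gcongr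
      _ = _ := by rw [Nat.factorial_succ]; push_cast; ring

variable (G) in
theorem sum_card_adj_pairs_le (r : ℕ) :
    ∑ Q ∈ G.cliqueFinset r, ∑ q ∈ Q,
      #{p : V × V | G.Adj p.1 p.2 ∧ ∀ w ∈ Q.erase q, G.Adj p.1 w ∧ G.Adj p.2 w} ≤
      #(G.cliqueFinset (r + 1)) * ((r + 1) ^ 2 * Fintype.card V) := by
  let P (Q : Finset V) (q : V) : Finset (V × V) :=
    {p | G.Adj p.1 p.2 ∧ ∀ w ∈ Q.erase q, G.Adj p.1 w ∧ G.Adj p.2 w}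
  let A := (G.cliqueFinset r).sigma fun Q ↦ Q.sigma fun q ↦ P Q q
  let B := (G.cliqueFinset (r + 1)).sigma fun K ↦ (univ : Finset V) ×ˢ (K ×ˢ K)
  have hA : #A = ∑ Q ∈ G.cliqueFinset r, ∑ q ∈ Q, #(P Q q) := by simp [A, card_sigma]
  have hB : #B = #(G.cliqueFinset (r + 1)) * ((r + 1) ^ 2 * Fintype.card V) := by
    simp only [B, card_sigma, card_product]
    rw [sum_const_nat fun K hK ↦ ?_]
    rw [(mem_cliqueFinset_iff.1 hK).card_eq, card_univ]
    ring
  rw [← hB]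
  change ∑ Q ∈ G.cliqueFinset r, ∑ q ∈ Q, #(P Q q) ≤ _
  rw [← hA]
  have notMem {Q : Finset V} {q : V} {p : V × V} (hp : p ∈ P Q q) :
      p.1 ∉ Q.erase q ∧ p.2 ∉ Q.erase q := by
    simp only [P, mem_filter, mem_univ, true_and] at hp
    exact ⟨fun h ↦ (hp.2 _ h).1.ne rfl, fun h ↦ (hp.2 _ h).2.ne rfl⟩
  refine card_le_card_of_injOn
    (fun a ↦ ⟨insert a.2.2.1 (insert a.2.2.2 (a.1.erase a.2.1)), (a.2.1, a.2.2)⟩) ?_ ?_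
  · rintro ⟨Q, q, u, v⟩ ha
    simp only [A, P, coe_sigma, Set.mem_sigma_iff, mem_coe, mem_cliqueFinset_iff,
      mem_filter, mem_univ, true_and] at ha
    obtain ⟨hQ, hq, huv, hadj⟩ := ha
    simp only [B, coe_sigma, Set.mem_sigma_iff, mem_coe, mem_cliqueFinset_iff, mem_product,
      mem_univ, true_and, mem_insert]
    refine ⟨?_, by simp⟩
    have hr : r - 1 + 1 = r := Nat.sub_add_cancel (by rw [← hQ.card_eq]; exact card_pos.2 ⟨q, hq⟩)
    have h₁ := (hQ.erase_of_mem hq).insert fun b hb ↦ (hadj b hb).2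
    rw [hr] at h₁
    refine h₁.insert fun b hb ↦ ?_
    obtain rfl | hb := mem_insert.1 hb
    · exact huv
    · exact (hadj b hb).1
  · rintro ⟨Q, q, u, v⟩ ha ⟨Q', q', u', v'⟩ ha' h
    simp only [A, coe_sigma, Set.mem_sigma_iff, mem_coe] at ha ha'
    simp only [Sigma.mk.injEq, heq_eq_eq, Prod.mk.injEq] at h
    obtain ⟨h, rfl, rfl, rfl⟩ := h
    have h₁ := notMem ha.2.2
    have h₂ := notMem ha'.2.2
    have : Q.erase q = Q'.erase q := by
      ext w
      have := congrArg (w ∈ ·) h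
      simp only [mem_insert, eq_iff_iff] at this
      by_cases hwu : w = u
      · subst hwu; simp only [h₁.1, h₂.1]
      by_cases hwv : w = v
      · subst hwv; simp only [h₁.2, h₂.2]
      simpa [hwu, hwv] using this
    have : Q = Q' := by rw [← insert_erase ha.2.1, this, insert_erase ha'.2.1]
    subst this; rfl

theorem prod_le_card_cliqueFinset_transversal {ι : Type*} [DecidableEq ι] {t : ℝ} (ht : 0 ≤ t)
    (b : ι → ℝ) (I : Finset ι) (hb : ∀ i ∈ I, 0 ≤ b i) (A : ι → Finset V)
    (hA : (I : Set ι).PairwiseDisjoint A)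
    (hmiss : ∀ i ∈ I, ∀ v ∈ A i, ∀ k ∈ I, k ≠ i → (#{w ∈ A k | ¬ G.Adj v w} : ℝ) ≤ t)
    (hcard : ∀ i ∈ I, b i + #I * t ≤ #(A i)) :
    ∏ i ∈ I, b i ≤ #{s ∈ G.cliqueFinset #I | s ⊆ I.biUnion A} := by
  induction I using Finset.induction_on generalizing A with
  | empty =>
    have : (∅ : Finset V) ∈ ({s ∈ G.cliqueFinset #(∅ : Finset ι) | s ⊆ (∅ : Finset ι).biUnion A}) := by
      simp
    simpa using card_pos.2 ⟨_, this⟩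
  | insert i I hi ih =>
    rw [coe_insert, Set.pairwiseDisjoint_insert_of_notMem (by simpa using hi)] at hA
    simp only [mem_insert, forall_eq_or_imp] at hb
    rw [card_insert_of_notMem hi] at hcard
    have hne : ∀ k ∈ I, k ≠ i := fun k hk h ↦ hi (h ▸ hk)
    let A' (v : V) (k : ι) : Finset V := {w ∈ A k | G.Adj v w}
    let S (v : V) : Finset (Finset V) := {s ∈ G.cliqueFinset #I | s ⊆ I.biUnion (A' v)}
    have hS : ∀ v ∈ A i, ∏ k ∈ I, b k ≤ #(S v) := by
      refine fun v hv ↦ ih hb.2 (A' v) (fun j hj k hk hjk ↦ ?_) (fun j hj w hw k hk hkj ↦ ?_)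
        fun k hk ↦ ?_
      · exact (hA.1 hj hk hjk).mono (filter_subset _ _) (filter_subset _ _)
      · refine (hmiss j (mem_insert_of_mem hj) w (mem_of_mem_filter w hw) k
          (mem_insert_of_mem hk) hkj).trans' ?_
        exact_mod_cast card_le_card (filter_subset_filter _ (filter_subset _ _))
      · have h₁ := hcard k (mem_insert_of_mem hk)
        have h₂ := hmiss i (mem_insert_self _ _) v hv k (mem_insert_of_mem hk) (hne k hk)
        have h₃ := card_filter_add_card_filter_not (s := A k) (fun w ↦ G.Adj v w)
        rw [← h₃] at h₁
        push_cast at h₁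
        change _ ≤ (#{w ∈ A k | G.Adj v w} : ℝ)
        linarith
    have hdisj : ∀ v ∈ A i, ∀ w, ∀ s ∈ S w, v ∉ s := by
      intro v hv w s hs hvs
      obtain ⟨k, hk, hvk⟩ := mem_biUnion.1 ((mem_filter.1 hs).2 hvs)
      exact Finset.disjoint_left.1 (hA.2 k hk) hv (mem_of_mem_filter v hvk)
    calc ∏ k ∈ insert i I, b k = b i * ∏ k ∈ I, b k := prod_insert hi
      _ ≤ #(A i) * ∏ k ∈ I, b k := by
          refine mul_le_mul_of_nonneg_right ?_ (prod_nonneg hb.2)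
          refine (hcard i (mem_insert_self _ _)).trans' ?_
          have : 0 ≤ ((#I + 1 : ℕ) : ℝ) * t := by positivity
          linarith
      _ = ∑ v ∈ A i, ∏ k ∈ I, b k := by simp
      _ ≤ ∑ v ∈ A i, (#(S v) : ℝ) := sum_le_sum hS
      _ = #((A i).sigma S) := by simp [card_sigma]
      _ ≤ _ := by
          norm_cast
          refine card_le_card_of_injOn (fun a ↦ insert a.1 a.2) ?_ ?_
          · rintro ⟨v, s⟩ ha
            simp only [coe_sigma, Set.mem_sigma_iff, mem_coe] at ha
            obtain ⟨hv, hs⟩ := ha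
            simp only [S, mem_filter, mem_cliqueFinset_iff] at hs
            simp only [coe_filter, mem_cliqueFinset_iff, Set.mem_ofPred_eq, biUnion_insert,
              card_insert_of_notMem hi]
            have hsA {w : V} (hw : w ∈ s) : w ∈ I.biUnion A ∧ G.Adj v w := by
              obtain ⟨k, hk, hwk⟩ := mem_biUnion.1 (hs.2 hw)
              rw [mem_filter] at hwk
              exact ⟨mem_biUnion.2 ⟨k, hk, hwk.1⟩, hwk.2⟩
            refine ⟨hs.1.insert fun w hw ↦ (hsA hw).2, insert_subset (mem_union_left _ hv) ?_⟩
            exact fun w hw ↦ mem_union_right _ (hsA hw).1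
          · rintro ⟨v, s⟩ ha ⟨v', s'⟩ ha' h
            simp only [coe_sigma, Set.mem_sigma_iff, mem_coe] at ha ha'
            change insert v s = insert v' s' at h
            have hv : v = v' := by
              have : v ∈ insert v' s' := by rw [← h]; simp
              exact (mem_insert.1 this).resolve_right (hdisj v ha.1 v' s' ha'.2)
            subst hv
            have : s = s' := by
              rw [← erase_insert (hdisj v ha.1 v s ha.2), h,
                erase_insert (hdisj v ha.1 v s' ha'.2)]
            rw [this]

theorem prod_le_card_cliqueFinset_of_adj {ι : Type*} [DecidableEq ι] {t : ℝ} (ht : 0 ≤ t)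
    (b : ι → ℝ) (I : Finset ι) (hb : ∀ i ∈ I, 0 ≤ b i) (A : ι → Finset V)
    (hA : (I : Set ι).PairwiseDisjoint A)
    (hmiss : ∀ i ∈ I, ∀ v ∈ A i, ∀ k ∈ I, k ≠ i → (#{w ∈ A k | ¬ G.Adj v w} : ℝ) ≤ t)
    {u v : V} (huv : G.Adj u v)
    (hcard : ∀ i ∈ I, b i + #I * t ≤ #{w ∈ A i | G.Adj u w ∧ G.Adj v w}) :
    ∏ i ∈ I, b i ≤ #{s ∈ G.cliqueFinset (#I + 2) | u ∈ s ∧ v ∈ s} := by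
  refine (prod_le_card_cliqueFinset_transversal (G := G) ht b I hb
    (fun i ↦ {w ∈ A i | G.Adj u w ∧ G.Adj v w}) ?_ ?_ hcard).trans ?_
  · exact fun j hj k hk hjk ↦ (hA hj hk hjk).mono (filter_subset _ _) (filter_subset _ _)
  · refine fun j hj w hw k hk hkj ↦ (hmiss j hj w (mem_of_mem_filter w hw) k hk hkj).trans' ?_
    exact_mod_cast card_le_card (filter_subset_filter _ (filter_subset _ _))
  have hadj {s : Finset V} (hs : s ⊆ I.biUnion fun i ↦ {w ∈ A i | G.Adj u w ∧ G.Adj v w}) :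
      ∀ w ∈ s, G.Adj u w ∧ G.Adj v w := by
    intro w hw
    obtain ⟨i, -, hi⟩ := mem_biUnion.1 (hs hw)
    exact (mem_filter.1 hi).2
  norm_cast
  refine card_le_card_of_injOn (fun s ↦ insert u (insert v s)) (fun s hs ↦ ?_)
    fun s hs s' hs' h ↦ ?_
  · simp only [coe_filter, mem_cliqueFinset_iff, Set.mem_ofPred_eq] at hs ⊢
    have := hadj hs.2
    refine ⟨(hs.1.insert fun w hw ↦ (this w hw).2).insert fun w hw ↦ ?_, by simp, by simp⟩
    obtain rfl | hw := mem_insert.1 hw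
    · exact huv
    · exact (this w hw).1
  · have h₁ := hadj (mem_filter.1 hs).2
    have h₂ := hadj (mem_filter.1 hs').2
    ext w
    have := congrArg (w ∈ ·) h
    simp only [mem_insert, eq_iff_iff] at this
    by_cases hwu : w = u
    · subst hwu
      exact iff_of_false (fun h ↦ (h₁ w h).1.ne rfl) fun h ↦ (h₂ w h).1.ne rfl
    by_cases hwv : w = v
    · subst hwv
      exact iff_of_false (fun h ↦ (h₁ w h).2.ne rfl) fun h ↦ (h₂ w h).2.ne rfl
    simpa [hwu, hwv] using this

end Count
/-- `G` has almost full minimum degree and the disjoint sets `C q`, for `q ∈ Q`, form an almost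
complete balanced `#Q`-partite subgraph on almost all vertices, with error parameter `ρ`. -/
structure IsNearTuran {V ι : Type*} [Fintype V] (G : SimpleGraph V) [DecidableRel G.Adj]
    (Q : Finset ι) (C : ι → Finset V) (ρ : ℝ) : Prop where
  disjoint : (Q : Set ι).PairwiseDisjoint C
  card_le : ∀ q ∈ Q, (#(C q) : ℝ) ≤ (1 / #Q + ρ) * Fintype.card V
  le_sum : (1 - ρ) * Fintype.card V ≤ ∑ q ∈ Q, (#(C q) : ℝ)
  card_not_adj_le : ∀ q ∈ Q, ∀ v ∈ C q, ∀ k ∈ Q, k ≠ q →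
    (#{w ∈ C k | ¬ G.Adj v w} : ℝ) ≤ ρ * Fintype.card V
  le_degree : ∀ v, (1 - 1 / #Q - ρ) * Fintype.card V ≤ G.degree v

section Structure

variable {V : Type*} [Fintype V] [DecidableEq V] {G : SimpleGraph V} [DecidableRel G.Adj]

/-- The vertices whose only non-neighbour in `Q` is `q`. -/
def missingOnly (G : SimpleGraph V) [DecidableRel G.Adj] (Q : Finset V) (q : V) : Finset V :=
  {v | ¬ G.Adj v q ∧ ∀ w ∈ Q.erase q, G.Adj v w}

theorem mem_missingOnly {Q : Finset V} {q v : V} :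
    v ∈ G.missingOnly Q q ↔ ¬ G.Adj v q ∧ ∀ w ∈ Q.erase q, G.Adj v w := by
  simp [missingOnly]

theorem pairwiseDisjoint_missingOnly (Q : Finset V) :
    (Q : Set V).PairwiseDisjoint (G.missingOnly Q) := by
  intro q hq k hk hqk
  refine Finset.disjoint_left.2 fun v hv hv' ↦ ?_
  rw [mem_missingOnly] at hv hv'
  exact hv'.1 (hv.2 k (mem_erase.2 ⟨hqk.symm, hk⟩))

theorem card_adj_filter_add_two_le (Q : Finset V) (v : V) :
    #{q ∈ Q | G.Adj v q} + 2 ≤ #Q + #{q ∈ Q | v ∈ G.missingOnly Q q} +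
      2 * if ∀ q ∈ Q, G.Adj v q then 1 else 0 := by
  have h := card_filter_add_card_filter_not (s := Q) (fun q ↦ G.Adj v q)
  split_ifs with hfull
  · lia
  · push Not at hfull
    obtain ⟨q, hq, hvq⟩ := hfull
    have hmem : q ∈ ({q ∈ Q | ¬ G.Adj v q} : Finset V) := mem_filter.2 ⟨hq, hvq⟩
    have hpos := card_pos.2 ⟨q, hmem⟩
    by_cases h₁ : #{q ∈ Q | ¬ G.Adj v q} = 1
    · have : q ∈ ({q ∈ Q | v ∈ G.missingOnly Q q} : Finset V) := by
        refine mem_filter.2 ⟨hq, mem_missingOnly.2 ⟨hvq, fun w hw ↦ ?_⟩⟩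
        by_contra hvw
        exact (mem_erase.1 hw).1 (card_le_one.1 h₁.le w
          (mem_filter.2 ⟨mem_of_mem_erase hw, hvw⟩) q hmem)
      have := card_pos.2 ⟨q, this⟩
      lia
    · lia

theorem sum_degree_add_le (Q : Finset V) :
    ∑ q ∈ Q, G.degree q + 2 * Fintype.card V ≤ #Q * Fintype.card V +
      ∑ q ∈ Q, #(G.missingOnly Q q) + 2 * #{v | ∀ q ∈ Q, G.Adj v q} := by
  have h := sum_le_sum fun v (_ : v ∈ univ) ↦ G.card_adj_filter_add_two_le Q v
  simp only [sum_add_distrib, sum_const, smul_eq_mul, card_univ, ← mul_sum,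
    sum_boole, Nat.cast_id] at h
  have h₁ : ∑ v, #{q ∈ Q | G.Adj v q} = ∑ q ∈ Q, G.degree q := by
    rw [show ∑ v, #{q ∈ Q | G.Adj v q} = ∑ v, #(bipartiteAbove G.Adj Q v) from rfl,
      sum_card_bipartiteAbove_eq_sum_card_bipartiteBelow]
    refine sum_congr rfl fun q _ ↦ ?_
    rw [← card_neighborFinset_eq_degree, neighborFinset_eq_filter]
    simp only [bipartiteBelow, G.adj_comm]
  have h₂ : ∑ v, #{q ∈ Q | v ∈ G.missingOnly Q q} = ∑ q ∈ Q, #(G.missingOnly Q q) := by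
    rw [show ∑ v, #{q ∈ Q | v ∈ G.missingOnly Q q} =
      ∑ v, #(bipartiteAbove (fun v q ↦ v ∈ G.missingOnly Q q) Q v) from rfl,
      sum_card_bipartiteAbove_eq_sum_card_bipartiteBelow]
    refine sum_congr rfl fun q _ ↦ ?_
    simp [bipartiteBelow]
  rw [h₁, h₂] at h
  lia

theorem sum_card_missingOnly_pairs_le (Q : Finset V) :
    ∑ q ∈ Q, ∑ v ∈ G.missingOnly Q q, #{w ∈ G.missingOnly Q q | G.Adj v w} ≤
    ∑ q ∈ Q, #{p : V × V | G.Adj p.1 p.2 ∧ ∀ w ∈ Q.erase q, G.Adj p.1 w ∧ G.Adj p.2 w} := by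
  refine sum_le_sum fun q _ ↦ ?_
  rw [← card_sigma]
  refine card_le_card_of_injOn (fun a ↦ (a.1, a.2)) ?_ ?_
  · rintro ⟨v, w⟩ h
    simp only [coe_sigma, Set.mem_sigma_iff, mem_coe, mem_filter, mem_missingOnly] at h
    simp only [coe_filter, mem_univ, true_and, Set.mem_ofPred_eq]
    exact ⟨h.2.2, fun x hx ↦ ⟨h.1.2 x hx, h.2.1.2 x hx⟩⟩
  · rintro ⟨v, w⟩ _ ⟨v', w'⟩ _ h
    simp only [Prod.mk.injEq] at h
    obtain ⟨rfl, rfl⟩ := h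
    rfl

/-- A clique with few common neighbours and few edges between vertices joined to all but one of its
members gives an almost Turán structure on a graph with large minimum degree. -/
theorem exists_isNearTuran [Nonempty V] {ε σ : ℝ} (hε : 0 ≤ ε) (hσ : 0 < σ) (hσ₁ : σ ≤ 1)
    {Q : Finset V} (hQ : 2 ≤ #Q)
    (hdeg : ∀ v, (1 - 1 / #Q - ε) * Fintype.card V ≤ G.degree v)
    (hfull : (#{v | ∀ q ∈ Q, G.Adj v q} : ℝ) ≤ σ ^ 2 * Fintype.card V)
    (hpairs : ((∑ q ∈ Q, #{p : V × V | G.Adj p.1 p.2 ∧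
      ∀ w ∈ Q.erase q, G.Adj p.1 w ∧ G.Adj p.2 w} : ℕ) : ℝ) ≤ σ ^ 2 * Fintype.card V ^ 2) :
    ∃ C : V → Finset V, G.IsNearTuran Q C (2 * #Q * ε + 3 * σ) := by
  set m : ℝ := (Fintype.card V : ℝ) with hm
  set r : ℝ := (#Q : ℝ) with hr
  have hm₀ : 0 < m := by rw [hm]; exact_mod_cast Fintype.card_pos
  have hr₂ : 2 ≤ r := by rw [hr]; exact_mod_cast hQ
  have hσσ : σ ^ 2 ≤ σ := by nlinarith
  have hrr : r * (1 / r) = 1 := by field_simp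
  have hdeg' : ∀ v, m - (1 / r + ε) * m ≤ G.degree v := fun v ↦ by linarith [hdeg v]
  have hnot (v : V) : (#{w | ¬ G.Adj v w} : ℝ) ≤ (1 / r + ε) * m := by
    simpa only [G.adj_comm] using card_not_adj_le hdeg' v
  have hle (q : V) : (#(G.missingOnly Q q) : ℝ) ≤ (1 / r + ε) * m := by
    refine (card_not_adj_le hdeg' q).trans' ?_
    norm_cast
    exact card_le_card fun v hv ↦ by simpa using (mem_missingOnly.1 hv).1
  have hsum : (1 - r * ε - 2 * σ) * m ≤ ∑ q ∈ Q, (#(G.missingOnly Q q) : ℝ) := by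
    have h₁ : (∑ q ∈ Q, (G.degree q : ℝ)) + 2 * m ≤ r * m +
        ∑ q ∈ Q, (#(G.missingOnly Q q) : ℝ) + 2 * #{v | ∀ q ∈ Q, G.Adj v q} := by
      rw [hm, hr]
      exact_mod_cast G.sum_degree_add_le Q
    have h₂ : r * ((1 - 1 / r - ε) * m) ≤ ∑ q ∈ Q, (G.degree q : ℝ) := by
      rw [hr, ← nsmul_eq_mul]
      exact card_nsmul_le_sum _ _ _ fun q _ ↦ hdeg q
    have h₃ : r * ((1 - 1 / r - ε) * m) = (r - 1 - r * ε) * m := by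
      linear_combination -m * hrr
    nlinarith
  have hge : ∀ q ∈ Q, (1 / r - (2 * r - 1) * ε - 2 * σ) * m ≤ #(G.missingOnly Q q) := by
    intro q hq
    have h₁ : ∑ k ∈ Q.erase q, (#(G.missingOnly Q k) : ℝ) ≤ (r - 1) * ((1 / r + ε) * m) := by
      have := sum_le_card_nsmul (Q.erase q) (fun k ↦ (#(G.missingOnly Q k) : ℝ)) _
        fun k _ ↦ hle k
      rwa [nsmul_eq_mul, card_erase_of_mem hq, Nat.cast_sub (by lia), Nat.cast_one] at this
    rw [sum_erase_eq_sub hq] at h₁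
    have h₂ : (r - 1) * ((1 / r + ε) * m) = (1 - 1 / r + (r - 1) * ε) * m := by
      linear_combination m * hrr
    linarith
  let C (q : V) : Finset V :=
    {v ∈ G.missingOnly Q q | (#{w ∈ G.missingOnly Q q | G.Adj v w} : ℝ) ≤ σ * m}
  have hCsub (q : V) : C q ⊆ G.missingOnly Q q := filter_subset _ _
  have hbad : ∑ q ∈ Q, ((#(G.missingOnly Q q) : ℝ) - #(C q)) ≤ σ * m := by
    have h₁ : ∀ q ∈ Q, ((#(G.missingOnly Q q) : ℝ) - #(C q)) * (σ * m) ≤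
        ∑ v ∈ G.missingOnly Q q, (#{w ∈ G.missingOnly Q q | G.Adj v w} : ℝ) := by
      intro q _
      rw [← Nat.cast_sub (card_le_card (hCsub q)), ← card_sdiff_of_subset (hCsub q),
        ← nsmul_eq_mul]
      refine (card_nsmul_le_sum (G.missingOnly Q q \ C q)
        (fun v ↦ (#{w ∈ G.missingOnly Q q | G.Adj v w} : ℝ)) _ fun v hv ↦ ?_).trans ?_
      · simp only [C, mem_sdiff, mem_filter, not_and, not_le] at hv
        exact (hv.2 hv.1).le
      · exact sum_le_sum_of_subset_of_nonneg sdiff_subset fun _ _ _ ↦ by positivity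
    have h₂ := (sum_le_sum h₁).trans ((by exact_mod_cast G.sum_card_missingOnly_pairs_le Q :
      _ ≤ _).trans hpairs)
    rw [← sum_mul] at h₂
    have : 0 < σ * m := by positivity
    nlinarith
  refine ⟨C, fun q hq k hk hqk ↦ ?_, fun q hq ↦ ?_, ?_, fun q hq v hv k hk hkq ↦ ?_, fun v ↦ ?_⟩
  · exact (pairwiseDisjoint_missingOnly Q hq hk hqk).mono (hCsub q) (hCsub k)
  · refine (Nat.cast_le.2 (card_le_card (hCsub q))).trans ((hle q).trans ?_)
    refine mul_le_mul_of_nonneg_right ?_ hm₀.le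
    nlinarith
  · rw [sum_sub_distrib] at hbad
    have : 0 ≤ r * ε * m := by positivity
    change (1 - (2 * r * ε + 3 * σ)) * m ≤ _
    linarith
  · have h₁ := card_filter_add_card_filter_not (s := ({w | ¬ G.Adj v w} : Finset V))
      (fun w ↦ w ∈ G.missingOnly Q q)
    have h₂ := card_filter_add_card_filter_not (s := G.missingOnly Q q) (fun w ↦ G.Adj v w)
    have h₃ : ({w ∈ ({w | ¬ G.Adj v w} : Finset V) | w ∈ G.missingOnly Q q}) =
        ({w ∈ G.missingOnly Q q | ¬ G.Adj v w} : Finset V) := by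
      ext w; simp [and_comm]
    have h₄ : #{w ∈ C k | ¬ G.Adj v w} ≤
        #{w ∈ ({w | ¬ G.Adj v w} : Finset V) | w ∉ G.missingOnly Q q} := by
      refine card_le_card fun w hw ↦ ?_
      simp only [mem_filter, mem_univ, true_and] at hw ⊢
      exact ⟨hw.2, Finset.disjoint_left.1 (pairwiseDisjoint_missingOnly Q hk hq hkq)
        (hCsub k hw.1)⟩
    rw [h₃] at h₁
    have h₅ := (mem_filter.1 hv).2
    have h₆ := hnot v
    have h₇ := hge q hq
    rw [← h₁] at h₆
    rw [← h₂] at h₇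
    have h₈ : (#{w ∈ C k | ¬ G.Adj v w} : ℝ) ≤
        #{w ∈ ({w | ¬ G.Adj v w} : Finset V) | w ∉ G.missingOnly Q q} := by exact_mod_cast h₄
    push_cast at h₆ h₇
    linarith
  · refine (hdeg v).trans' (mul_le_mul_of_nonneg_right ?_ hm₀.le)
    nlinarith

end Structure
namespace IsNearTuran

variable {V ι : Type*} [Fintype V] [DecidableEq V] {G : SimpleGraph V}
  [DecidableRel G.Adj] {Q : Finset ι} {C : ι → Finset V} {ρ : ℝ}

theorem le_sum_card_adj (h : G.IsNearTuran Q C ρ) (u : V) :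
    (1 - 1 / #Q - 2 * ρ) * Fintype.card V ≤ ∑ q ∈ Q, (#{w ∈ C q | G.Adj u w} : ℝ) := by
  have h₁ : ∑ q ∈ Q, (#{w ∈ C q | ¬ G.Adj u w} : ℝ) ≤ Fintype.card V - G.degree u := by
    rw [← card_neighborFinset_eq_degree, neighborFinset_eq_filter,
      ← card_univ, ← card_filter_add_card_filter_not (s := univ) (fun w ↦ G.Adj u w)]
    push_cast
    rw [add_sub_cancel_left]
    norm_cast
    rw [← card_biUnion fun i hi j hj hij ↦ (h.disjoint hi hj hij).mono (filter_subset _ _)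
      (filter_subset _ _)]
    refine card_le_card fun w hw ↦ ?_
    simp only [mem_biUnion, mem_filter, mem_univ, true_and] at hw ⊢
    exact hw.choose_spec.2.2
  have h₂ : ∑ q ∈ Q, (#(C q) : ℝ) = ∑ q ∈ Q, (#{w ∈ C q | G.Adj u w} : ℝ) +
      ∑ q ∈ Q, (#{w ∈ C q | ¬ G.Adj u w} : ℝ) := by
    rw [← sum_add_distrib]
    refine sum_congr rfl fun q _ ↦ ?_
    exact_mod_cast (card_filter_add_card_filter_not _).symm
  linarith [h.le_sum, h.le_degree u]

variable [DecidableEq ι]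

theorem prod_le_card (h : G.IsNearTuran Q C ρ) (hρ : 0 ≤ ρ) {q : ι} (hq : q ∈ Q) {b : ι → ℝ}
    (hb : ∀ i ∈ Q.erase q, 0 ≤ b i) {u v : V} (huv : G.Adj u v)
    (hcard : ∀ i ∈ Q.erase q, b i + (#Q - 1) * (ρ * Fintype.card V) ≤
      #{w ∈ C i | G.Adj u w ∧ G.Adj v w}) :
    ∏ i ∈ Q.erase q, b i ≤ #{s ∈ G.cliqueFinset (#Q + 1) | u ∈ s ∧ v ∈ s} := by
  have hI : #(Q.erase q) + 1 = #Q := card_erase_add_one hq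
  rw [← hI]
  refine prod_le_card_cliqueFinset_of_adj (t := ρ * Fintype.card V) (by positivity) b (Q.erase q)
    hb C (h.disjoint.subset (by simp)) ?_ huv fun i hi ↦ ?_
  · exact fun i hi v hv k hk hki ↦ h.card_not_adj_le i (mem_of_mem_erase hi) v hv k
      (mem_of_mem_erase hk) hki
  · have := hcard i hi
    rw [← hI] at this
    push_cast at this
    simpa using this

/-- A vertex with linearly many neighbours in every part lies in an edge contained in many
cliques. -/
theorem exists_adj_of_le_card_adj [Nonempty V] (h : G.IsNearTuran Q C ρ) (hQ : 2 ≤ #Q)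
    (hρ : 0 < ρ) (hρQ : ρ ≤ 1 / (8 * #Q ^ 3)) {u : V} {q : ι} (hq : q ∈ Q)
    (hmin : ∀ j ∈ Q, #{w ∈ C q | G.Adj u w} ≤ #{w ∈ C j | G.Adj u w})
    (hle : 1 / (4 * #Q ^ 2) * Fintype.card V ≤ (#{w ∈ C q | G.Adj u w} : ℝ)) :
    ∃ w, G.Adj u w ∧
      (1 / (8 * #Q) : ℝ) ^ ((2 * #Q + #Q ^ 3) * ρ * #Q) *
        (((#Q : ℝ) - 1) / #Q ^ 2) ^ (#Q - 1) * (Fintype.card V : ℝ) ^ (#Q - 1) ≤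
      #{s ∈ G.cliqueFinset (#Q + 1) | u ∈ s ∧ w ∈ s} := by
  set m : ℝ := (Fintype.card V : ℝ) with hm
  have hm₀ : 0 < m := by rw [hm]; exact_mod_cast Fintype.card_pos
  have hI : #(Q.erase q) = #Q - 1 := card_erase_of_mem hq
  set r : ℝ := (#Q : ℝ) with hr
  have hr₂ : 2 ≤ r := by rw [hr]; exact_mod_cast hQ
  have hr₀ : 0 < r := by linarith
  set d : ι → ℝ := fun j ↦ #{w ∈ C j | G.Adj u w} with hd
  have hmin : ∀ j ∈ Q, d q ≤ d j := fun j hj ↦ Nat.cast_le.2 (hmin j hj)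
  have hsum : (1 - 1 / r - 2 * ρ) * m ≤ ∑ j ∈ Q, d j := h.le_sum_card_adj u
  have hdle : ∀ j ∈ Q, d j ≤ (1 / r + ρ) * m := fun j hj ↦
    (h.card_le j hj).trans' (Nat.cast_le.2 (card_filter_le _ _))
  have hdq : 1 / (4 * r ^ 2) * m ≤ d q := hle
  obtain ⟨w, hw⟩ : ({w ∈ C q | G.Adj u w} : Finset V).Nonempty := by
    rw [← card_pos, ← Nat.cast_pos (α := ℝ)]
    exact hdq.trans_lt' (by positivity)
  obtain ⟨hwC, huw⟩ := mem_filter.1 hw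
  refine ⟨w, huw, ?_⟩
  have hρr : r * ρ ≤ 1 / (8 * r ^ 2) := by
    calc r * ρ ≤ r * (1 / (8 * r ^ 3)) := by gcongr
      _ = 1 / (8 * r ^ 2) := by field_simp
  have hg : 1 / (8 * r ^ 2) + 1 / (8 * r ^ 2) = 1 / (4 * r ^ 2) := by field_simp; norm_num
  have hdq' : 1 / (8 * r ^ 2) * m ≤ d q - r * ρ * m := by nlinarith
  have hnonneg : ∀ j ∈ Q, 0 ≤ d j - r * ρ * m := fun j hj ↦ by
    have : 0 ≤ 1 / (8 * r ^ 2) * m := by positivity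
    linarith [hmin j hj]
  let y (j : ι) : ℝ := 1 - r / m * (d j - r * ρ * m)
  have hrm : 0 < r / m := by positivity
  have key : (1 - 1 / r) ^ (#Q - 1) * (1 / (8 * r)) ^ ((2 * r + r ^ 3) * ρ * r) ≤
      ∏ j ∈ Q.erase q, (1 - y j) := by
    refine mul_rpow_le_prod_one_sub hQ hq (fun j hj ↦ ?_) (fun j hj ↦ ?_) (by positivity) ?_
      (by positivity) ?_
    · have : r / m * (d j - r * ρ * m) ≤ r / m * (1 / r * m) := by
        gcongr
        have : 0 ≤ (r - 1) * (ρ * m) := mul_nonneg (by linarith) (by positivity)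
        linarith [hdle j hj]
      have h₂ : r / m * (1 / r * m) = 1 := by field_simp
      simp only [y]; linarith
    · have : r / m * (d q - r * ρ * m) ≤ r / m * (d j - r * ρ * m) := by
        gcongr; exact hmin j hj
      simp only [y]; linarith
    · have : r / m * (1 / (8 * r ^ 2) * m) ≤ r / m * (d q - r * ρ * m) := by gcongr
      have h₂ : r / m * (1 / (8 * r ^ 2) * m) = 1 / (8 * r) := by field_simp
      simp only [y]; linarith
    · simp only [y]
      rw [sum_sub_distrib, ← mul_sum, sum_sub_distrib]
      simp only [sum_const, nsmul_eq_mul, mul_one]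
      rw [← hr]
      have h₁ : r / m * ((1 - 1 / r - 2 * ρ) * m - r * (r * ρ * m)) ≤
          r / m * (∑ j ∈ Q, d j - r * (r * ρ * m)) := by gcongr
      have h₂ : r / m * ((1 - 1 / r - 2 * ρ) * m - r * (r * ρ * m)) =
          r - 1 - (2 * r + r ^ 3) * ρ := by field_simp; ring
      linarith
  have hb := h.prod_le_card hρ.le hq (b := fun j ↦ d j - r * ρ * m)
    (fun j hj ↦ hnonneg j (mem_of_mem_erase hj)) huw fun j hj ↦ by
      have h₁ := h.card_not_adj_le q hq w hwC j (mem_of_mem_erase hj) (ne_of_mem_erase hj)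
      have h₂ := card_filter_add_card_filter_not (s := {v ∈ C j | G.Adj u v}) (fun v ↦ G.Adj w v)
      have h₃ : #{v ∈ ({v ∈ C j | G.Adj u v} : Finset V) | ¬ G.Adj w v} ≤
          #{v ∈ C j | ¬ G.Adj w v} := card_le_card (filter_subset_filter _ (filter_subset _ _))
      rw [filter_filter] at h₂
      have h₄ : (#{v ∈ ({v ∈ C j | G.Adj u v} : Finset V) | ¬ G.Adj w v} : ℝ) ≤ ρ * m :=
        (Nat.cast_le.2 h₃).trans h₁
      have h₅ : d j = #{v ∈ C j | G.Adj u v ∧ G.Adj w v} +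
          #{v ∈ ({v ∈ C j | G.Adj u v} : Finset V) | ¬ G.Adj w v} := by
        simp only [hd]; exact_mod_cast h₂.symm
      change d j - r * ρ * m + (r - 1) * (ρ * m) ≤ _
      linarith
  have hprod : ∏ j ∈ Q.erase q, (d j - r * ρ * m) =
      (m / r) ^ (#Q - 1) * ∏ j ∈ Q.erase q, (1 - y j) := by
    rw [← hI, ← prod_const, ← prod_mul_distrib]
    refine prod_congr rfl fun j _ ↦ ?_
    simp only [y]; field_simp; ring
  rw [hprod] at hb
  refine hb.trans' ?_
  calc _ = (m / r) ^ (#Q - 1) * ((1 - 1 / r) ^ (#Q - 1) *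
        (1 / (8 * r)) ^ ((2 * r + r ^ 3) * ρ * r)) := by
        rw [mul_assoc, ← mul_pow, ← mul_assoc, ← mul_pow, mul_comm]
        congr 2
        field_simp
    _ ≤ _ := by gcongr

/-- An edge whose ends have few neighbours in the same part is contained in many cliques. -/
theorem le_card_of_card_adj_lt [Nonempty V] (h : G.IsNearTuran Q C ρ) (hQ : 2 ≤ #Q)
    (hρ : 0 < ρ) (hρQ : ρ ≤ 1 / (8 * #Q ^ 3)) {u v : V} (huv : G.Adj u v) {q : ι} (hq : q ∈ Q)
    (hu : (#{w ∈ C q | G.Adj u w} : ℝ) < 1 / (4 * #Q ^ 2) * Fintype.card V)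
    (hv : (#{w ∈ C q | G.Adj v w} : ℝ) < 1 / (4 * #Q ^ 2) * Fintype.card V) :
    (((#Q : ℝ) - 1) / #Q ^ 2) ^ (#Q - 1) * (Fintype.card V : ℝ) ^ (#Q - 1) ≤
      #{s ∈ G.cliqueFinset (#Q + 1) | u ∈ s ∧ v ∈ s} := by
  set m : ℝ := (Fintype.card V : ℝ) with hm
  have hm₀ : 0 < m := by rw [hm]; exact_mod_cast Fintype.card_pos
  have hI : #(Q.erase q) = #Q - 1 := card_erase_of_mem hq
  set r : ℝ := (#Q : ℝ) with hr
  have hr₂ : 2 ≤ r := by rw [hr]; exact_mod_cast hQ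
  have hr₀ : 0 < r := by linarith
  have hρr : r * ρ ≤ 1 / (8 * r ^ 2) := by
    calc r * ρ ≤ r * (1 / (8 * r ^ 3)) := by gcongr
      _ = 1 / (8 * r ^ 2) := by field_simp
  have hadj (x : V) (hx : (#{w ∈ C q | G.Adj x w} : ℝ) < 1 / (4 * r ^ 2) * m) :
      ∀ j ∈ Q.erase q, (1 / r - 1 / (4 * r ^ 2) - r * ρ) * m ≤ #{w ∈ C j | G.Adj x w} := by
    intro j hj
    have h₁ := h.le_sum_card_adj x
    rw [← add_sum_erase _ _ hq, ← add_sum_erase _ _ hj] at h₁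
    have h₂ : ∑ k ∈ (Q.erase q).erase j, (#{w ∈ C k | G.Adj x w} : ℝ) ≤
        (r - 2) * ((1 / r + ρ) * m) := by
      have := sum_le_card_nsmul ((Q.erase q).erase j) (fun k ↦ (#{w ∈ C k | G.Adj x w} : ℝ)) _
        fun k hk ↦ (h.card_le k (mem_of_mem_erase (mem_of_mem_erase hk))).trans'
          (Nat.cast_le.2 (card_filter_le _ _))
      rwa [nsmul_eq_mul, card_erase_of_mem hj, hI, Nat.sub_sub, Nat.cast_sub (by lia)] at this
    have h₃ : (r - 2) * ((1 / r + ρ) * m) = (1 - 2 * (1 / r) + (r - 2) * ρ) * m := by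
      field_simp
    change (1 - 1 / r - 2 * ρ) * m ≤ _ at h₁
    linarith
  have hb := h.prod_le_card hρ.le hq (b := fun _ ↦ (r - 1) / r ^ 2 * m)
    (fun j _ ↦ mul_nonneg (div_nonneg (by linarith) (by positivity)) hm₀.le) huv fun j hj ↦ by
      have h₁ := hadj u hu j hj
      have h₂ := hadj v hv j hj
      have h₃ := card_union_add_card_inter {w ∈ C j | G.Adj u w} {w ∈ C j | G.Adj v w}
      have h₄ : #({w ∈ C j | G.Adj u w} ∪ {w ∈ C j | G.Adj v w}) ≤ #(C j) :=
        card_le_card (union_subset (filter_subset _ _) (filter_subset _ _))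
      rw [← filter_and] at h₃
      have h₅ : (#{w ∈ C j | G.Adj u w} : ℝ) + #{w ∈ C j | G.Adj v w} ≤
          (1 / r + ρ) * m + #{w ∈ C j | G.Adj u w ∧ G.Adj v w} := by
        have : (#({w ∈ C j | G.Adj u w} ∪ {w ∈ C j | G.Adj v w}) : ℝ) ≤ (1 / r + ρ) * m :=
          (Nat.cast_le.2 h₄).trans (h.card_le j (mem_of_mem_erase hj))
        have h₆ : (#({w ∈ C j | G.Adj u w} ∪ {w ∈ C j | G.Adj v w}) : ℝ) +
          #{w ∈ C j | G.Adj u w ∧ G.Adj v w} = #{w ∈ C j | G.Adj u w} +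
            #{w ∈ C j | G.Adj v w} := by exact_mod_cast h₃
        linarith
      have h₇ : (r - 1) / r ^ 2 + 2 * (1 / (4 * r ^ 2)) + 4 * (1 / (8 * r ^ 2)) = 1 / r := by
        field_simp; ring
      change (r - 1) / r ^ 2 * m + (r - 1) * (ρ * m) ≤ _
      have h₈ : ((r - 1) / r ^ 2 + (r - 1) * ρ) * m ≤
          (2 * (1 / r - 1 / (4 * r ^ 2) - r * ρ) - (1 / r + ρ)) * m := by
        have : 0 < 1 / (8 * r ^ 2) := by positivity
        gcongr
        linarith
      linarith
  rwa [prod_const, hI, mul_pow] at hb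

theorem exists_adj [Nonempty V] (h : G.IsNearTuran Q C ρ) (hQ : 2 ≤ #Q)
    (hρ : 0 < ρ) (hρQ : ρ ≤ 1 / (8 * #Q ^ 3)) (hG : ¬ G.CliqueFree (#Q + 1)) :
    ∃ u v, G.Adj u v ∧
      (1 / (8 * #Q) : ℝ) ^ ((2 * #Q + #Q ^ 3) * ρ * #Q) *
        (((#Q : ℝ) - 1) / #Q ^ 2) ^ (#Q - 1) * (Fintype.card V : ℝ) ^ (#Q - 1) ≤
      #{s ∈ G.cliqueFinset (#Q + 1) | u ∈ s ∧ v ∈ s} := by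
  have hQne : Q.Nonempty := card_pos.1 (by lia)
  choose f hfQ hf using fun u ↦ exists_min_image Q (fun q ↦ #{w ∈ C q | G.Adj u w}) hQne
  simp only [CliqueFree, not_forall, not_not] at hG
  obtain ⟨K, hK⟩ := hG
  obtain ⟨u, hu, v, hv, huv, hfuv⟩ := exists_ne_map_eq_of_card_lt_of_maps_to
    (s := K) (t := Q) (by rw [hK.card_eq]; lia) (fun u _ ↦ hfQ u)
  by_cases hu' : 1 / (4 * #Q ^ 2) * Fintype.card V ≤ (#{w ∈ C (f u) | G.Adj u w} : ℝ)
  · exact ⟨u, h.exists_adj_of_le_card_adj hQ hρ hρQ (hfQ u) (hf u) hu'⟩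
  by_cases hv' : 1 / (4 * #Q ^ 2) * Fintype.card V ≤ (#{w ∈ C (f v) | G.Adj v w} : ℝ)
  · exact ⟨v, h.exists_adj_of_le_card_adj hQ hρ hρQ (hfQ v) (hf v) hv'⟩
  have hadj := hK.isClique hu hv huv
  rw [← hfuv] at hv'
  refine ⟨u, v, hadj, (h.le_card_of_card_adj_lt hQ hρ hρQ hadj (hfQ u) (not_le.1 hu')
    (not_le.1 hv')).trans' ?_⟩
  have hr₂ : (2 : ℝ) ≤ #Q := by exact_mod_cast hQ
  have h₁ : (1 / (8 * #Q) : ℝ) ^ ((2 * #Q + #Q ^ 3) * ρ * #Q) ≤ 1 :=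
    Real.rpow_le_one (by positivity) (by rw [div_le_one (by linarith)]; linarith) (by positivity)
  rw [mul_assoc]
  refine mul_le_of_le_one_left (mul_nonneg (pow_nonneg (div_nonneg ?_ ?_) _) ?_) h₁
  · linarith
  · positivity
  · positivity

end IsNearTuran
/-- A graph with large minimum degree and few copies of `K_{r+1}` has an `r`-clique with few common
neighbours and few adjacent pairs of vertices that are both joined to `r - 1` of its vertices. -/
theorem exists_clique_of_card_le {V : Type*} [Fintype V] [DecidableEq V] [Nonempty V]
    {G : SimpleGraph V} [DecidableRel G.Adj] {r : ℕ} (hr : 2 ≤ r) {ε δ : ℝ} (hε : 0 ≤ ε)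
    (hεr : ε ≤ 1 / (2 * r ^ 2))
    (hdeg : ∀ v, (1 - 1 / r - ε) * Fintype.card V ≤ G.degree v)
    (hδ : (#(G.cliqueFinset (r + 1)) : ℝ) * (((r : ℝ) + 1) + (r + 1) ^ 2) * r.factorial ≤
      δ * (1 / (2 * r)) ^ r * Fintype.card V ^ (r + 1)) :
    ∃ Q ∈ G.cliqueFinset r, (#{v | ∀ q ∈ Q, G.Adj v q} : ℝ) ≤ δ * Fintype.card V ∧
      ((∑ q ∈ Q, #{p : V × V | G.Adj p.1 p.2 ∧
        ∀ w ∈ Q.erase q, G.Adj p.1 w ∧ G.Adj p.2 w} : ℕ) : ℝ) ≤ δ * Fintype.card V ^ 2 := by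
  set m : ℝ := (Fintype.card V : ℝ) with hm
  have hm₀ : 0 < m := by rw [hm]; exact_mod_cast Fintype.card_pos
  have hr₂ : (2 : ℝ) ≤ r := by exact_mod_cast hr
  have hr₀ : (0 : ℝ) < r := by linarith
  have hk : (1 / (2 * r) * m) ^ r ≤ r.factorial * #(G.cliqueFinset r) := by
    refine pow_le_factorial_mul_card_cliqueFinset (x := (1 / r + ε) * m) (by positivity)
      (by positivity) (fun v ↦ ?_) ?_
    · refine (hdeg v).trans' (le_of_eq ?_)
      ring
    · have h₁ : ((r : ℝ) - 1) * ε ≤ r * (1 / (2 * r ^ 2)) := by gcongr; linarith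
      have h₂ : 1 / (2 * (r : ℝ)) + (r - 1) * (1 / r) + r * (1 / (2 * r ^ 2)) = 1 := by
        field_simp; ring
      calc _ = (1 / (2 * (r : ℝ)) + (r - 1) * (1 / r) + (r - 1) * ε) * m := by ring
        _ ≤ 1 * m := by gcongr; linarith
        _ = m := one_mul m
  have hfact : (0 : ℝ) < r.factorial := by exact_mod_cast r.factorial_pos
  have hne : (G.cliqueFinset r).Nonempty := by
    rw [← card_pos, ← Nat.cast_pos (α := ℝ)]
    exact pos_of_mul_pos_right (hk.trans_lt' (by positivity)) hfact.le
  let a (Q : Finset V) : ℝ := (#{v | ∀ q ∈ Q, G.Adj v q} : ℝ)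
  let b (Q : Finset V) : ℝ := ((∑ q ∈ Q, #{p : V × V | G.Adj p.1 p.2 ∧
        ∀ w ∈ Q.erase q, G.Adj p.1 w ∧ G.Adj p.2 w} : ℕ) : ℝ)
  have ha : ∑ Q ∈ G.cliqueFinset r, a Q ≤ (r + 1) * #(G.cliqueFinset (r + 1)) := by
    simp only [a]; exact_mod_cast G.sum_card_commonNeighbors_le r
  have hb : ∑ Q ∈ G.cliqueFinset r, b Q ≤ #(G.cliqueFinset (r + 1)) * ((r + 1) ^ 2 * m) := by
    simp only [b, hm]; exact_mod_cast G.sum_card_adj_pairs_le r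
  have hpos : (0 : ℝ) < (((r : ℝ) + 1) + (r + 1) ^ 2) := by positivity
  have hδ₀ : 0 ≤ δ := by
    by_contra! h
    have h₁ : δ * (1 / (2 * r)) ^ r * m ^ (r + 1) < 0 := by
      rw [mul_assoc]; exact mul_neg_of_neg_of_pos h (by positivity)
    exact h₁.not_ge (hδ.trans' (by positivity))
  have hsum : (r + 1) * #(G.cliqueFinset (r + 1)) * m +
      #(G.cliqueFinset (r + 1)) * ((r + 1) ^ 2 * m) ≤ #(G.cliqueFinset r) * (δ * m ^ 2) := by
    generalize (#(G.cliqueFinset (r + 1)) : ℝ) = K at *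
    generalize (#(G.cliqueFinset r) : ℝ) = k at *
    refine le_of_mul_le_mul_left ?_ hfact
    calc _ = (K * (((r : ℝ) + 1) + (r + 1) ^ 2) * r.factorial) * m := by ring
      _ ≤ δ * (1 / (2 * r)) ^ r * m ^ (r + 1) * m := by gcongr
      _ = δ * m ^ 2 * (1 / (2 * r) * m) ^ r := by ring
      _ ≤ δ * m ^ 2 * (r.factorial * k) := by gcongr
      _ = _ := by ring
  obtain ⟨Q, hQ, hQle⟩ := exists_le_of_sum_le (f := fun Q ↦ a Q * m + b Q)
    (g := fun _ ↦ δ * m ^ 2) hne (by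
      rw [sum_add_distrib, ← sum_mul, sum_const, nsmul_eq_mul]
      exact hsum.trans' (by gcongr))
  have ha₀ : 0 ≤ a Q := Nat.cast_nonneg _
  have hb₀ : 0 ≤ b Q := Nat.cast_nonneg _
  refine ⟨Q, hQ, ?_, ?_⟩
  · refine le_of_mul_le_mul_right ?_ hm₀
    change a Q * m ≤ _
    nlinarith
  · change b Q ≤ _
    have := mul_nonneg ha₀ hm₀.le
    linarith

/-- In a graph with large minimum degree which contains a `K_{r+1}`, but only few of them, some edge
lies in many of them. -/
theorem exists_adj_of_card_le {r : ℕ} (hr : 2 ≤ r) {η : ℝ} (hη : 0 < η) :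
    ∃ ε : ℝ, 0 < ε ∧ ∃ δ : ℝ, 0 < δ ∧ ∀ {V : Type u} [Fintype V] [DecidableEq V] [Nonempty V] (G : SimpleGraph V)
      [DecidableRel G.Adj], (∀ v, (1 - 1 / r - ε) * Fintype.card V ≤ G.degree v) →
      (#(G.cliqueFinset (r + 1)) : ℝ) ≤ δ * Fintype.card V ^ (r + 1) →
      ¬ G.CliqueFree (r + 1) →
      ∃ u v, G.Adj u v ∧
        (1 - η) * (((r : ℝ) - 1) / r ^ 2) ^ (r - 1) * (Fintype.card V : ℝ) ^ (r - 1) ≤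
          #{s ∈ G.cliqueFinset (r + 1) | u ∈ s ∧ v ∈ s} := by
  have hr₂ : (2 : ℝ) ≤ r := by exact_mod_cast hr
  have hr₀ : (0 : ℝ) < r := by linarith
  obtain ⟨ρ, hρ, hρr, hρη⟩ : ∃ ρ : ℝ, 0 < ρ ∧ ρ ≤ 1 / (8 * (r : ℝ) ^ 3) ∧
      1 - η ≤ (1 / (8 * r) : ℝ) ^ ((2 * r + r ^ 3) * ρ * r) := by
    have hcont : Continuous fun ρ : ℝ ↦ (1 / (8 * r) : ℝ) ^ ((2 * r + r ^ 3) * ρ * r) :=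
      Real.continuous_const_rpow (by positivity) |>.comp (by fun_prop)
    have h₁ : ∀ᶠ ρ : ℝ in nhdsWithin (0 : ℝ) (Set.Ioi 0),
        1 - η < (1 / (8 * r) : ℝ) ^ ((2 * r + r ^ 3) * ρ * r) := by
      refine (hcont.tendsto 0).mono_left nhdsWithin_le_nhds |>.eventually_const_lt ?_
      simpa
    have h₂ : ∀ᶠ ρ : ℝ in nhdsWithin (0 : ℝ) (Set.Ioi 0), ρ ≤ 1 / (8 * (r : ℝ) ^ 3) :=
      nhdsWithin_le_nhds (Iic_mem_nhds (by positivity))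
    obtain ⟨ρ, ⟨hρ₁, hρ₂⟩, hρ⟩ := ((h₁.and h₂).and self_mem_nhdsWithin).exists
    exact ⟨ρ, hρ, hρ₂, hρ₁.le⟩
  refine ⟨ρ / (4 * r), by positivity,
    (ρ / 6) ^ 2 * (1 / (2 * r)) ^ r / ((((r : ℝ) + 1) + (r + 1) ^ 2) * r.factorial),
    by positivity, fun {V} _ _ _ G _ hdeg hcard hG ↦ ?_⟩
  have hρ₁ : ρ ≤ 1 := hρr.trans <| by
    rw [div_le_one (by positivity)]
    have : (1 : ℝ) ≤ r ^ 3 := one_le_pow₀ (by linarith)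
    linarith
  have hε : ρ / (4 * r) ≤ 1 / (2 * (r : ℝ) ^ 2) := by
    calc ρ / (4 * r) ≤ 1 / (8 * (r : ℝ) ^ 3) / (4 * r) := by gcongr
      _ = 1 / (2 * (r : ℝ) ^ 2) * (1 / (16 * r ^ 2)) := by field_simp; norm_num
      _ ≤ 1 / (2 * (r : ℝ) ^ 2) * 1 := by
        gcongr
        rw [div_le_one (by positivity)]
        nlinarith
      _ = _ := mul_one _
  obtain ⟨Q, hQ, hfull, hpairs⟩ := exists_clique_of_card_le (δ := (ρ / 6) ^ 2) hr (by positivity)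
    hε hdeg (by
      rw [mul_assoc, ← le_div_iff₀ (by positivity)]
      exact hcard.trans_eq (div_mul_eq_mul_div _ _ _))
  have hQr : #Q = r := (mem_cliqueFinset_iff.1 hQ).card_eq
  subst hQr
  obtain ⟨C, hC⟩ := exists_isNearTuran (ε := ρ / (4 * #Q)) (σ := ρ / 6) (by positivity)
    (by positivity) (by linarith) hr hdeg hfull hpairs
  have hρ' : 2 * #Q * (ρ / (4 * #Q)) + 3 * (ρ / 6) = ρ := by field_simp; norm_num
  rw [hρ'] at hC
  obtain ⟨u, v, huv, h⟩ := hC.exists_adj hr hρ hρr hG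
  refine ⟨u, v, huv, h.trans' ?_⟩
  have : (0 : ℝ) ≤ #Q - 1 := by linarith
  gcongr

/-- Supersaturation for cliques: exceeding the Turán density yields a positive proportion of copies
of `K_{r+1}`. -/
theorem le_card_cliqueFinset_of_le_card_edgeFinset {V : Type u} [Fintype V] [DecidableEq V]
    (G : SimpleGraph V) [DecidableRel G.Adj] {r : ℕ} (hr : 1 ≤ r) {c n : ℝ} (hc : 0 < c)
    (hn : 2 ≤ c * n) (hV : Fintype.card V ≤ n)
    (hE : (1 - 1 / r) * Fintype.card V ^ 2 / 2 + c * n ^ 2 ≤ #G.edgeFinset) :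
    (c / 4) ^ (r + 1) / (r + 1).factorial * n ^ (r + 1) ≤ #(G.cliqueFinset (r + 1)) := by
  have hn₀ : 0 < n := pos_of_mul_pos_right (by linarith) hc.le
  have hr₁ : (1 : ℝ) ≤ r := by exact_mod_cast hr
  have hr₀ : (0 : ℝ) < r := by linarith
  have hr' : 1 / (r : ℝ) ≤ 1 := by rw [div_le_one hr₀]; exact hr₁
  obtain ⟨W, _, _, H, _, ⟨φ⟩, hHE, hdeg⟩ := exists_embedding_le_degree G
    fun t ↦ (1 - 1 / r) * t ^ 2 / 2 + c / 2 * n * t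
  have hpos : 0 < #H.edgeFinset := by
    rw [← Nat.cast_pos (α := ℝ)]
    have h₁ : 0 ≤ (1 - 1 / (r : ℝ)) * Fintype.card W ^ 2 / 2 :=
      div_nonneg (mul_nonneg (by linarith) (by positivity)) (by norm_num)
    have h₂ : 0 ≤ c / 2 * n * Fintype.card W := by positivity
    have h₃ : c / 2 * n * Fintype.card V ≤ c / 2 * n * n := by gcongr
    nlinarith [mul_pos hc (pow_pos hn₀ 2)]
  obtain ⟨e, he⟩ := card_pos.1 hpos
  have hW : Nonempty W := ⟨e.out.1⟩
  have hW₁ : 1 ≤ Fintype.card W := Fintype.card_pos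
  set t : ℝ := (Fintype.card W : ℝ) with ht
  let x : ℝ := t / r + (1 - 1 / r) / 2 - c / 2 * n
  have hdeg' (v : W) : Fintype.card W - x ≤ H.degree v := by
    refine (hdeg v).trans' (le_of_eq ?_)
    rw [Nat.cast_sub hW₁, ← ht]
    simp only [x, Nat.cast_one]
    ring
  have hx : 0 ≤ x := by
    have v := hW.some
    have h₁ : (H.degree v : ℝ) ≤ Fintype.card W := by exact_mod_cast (H.degree_lt_card_verts v).le
    linarith [hdeg' v]
  have h := pow_le_factorial_mul_card_cliqueFinset (y := c / 4 * n) (k := r + 1) hx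
    (by positivity) hdeg' (by
      have h₁ : (r : ℝ) * x = t + (r - 1) / 2 - r * (c * n) / 2 := by
        simp only [x]; field_simp
      have h₂ : (r : ℝ) * 2 ≤ r * (c * n) := by gcongr
      have h₃ : 1 * (c * n) ≤ r * (c * n) := by gcongr
      push_cast
      rw [← ht, add_sub_cancel_right, h₁]
      linarith)
  have hφ : (#(H.cliqueFinset (r + 1)) : ℝ) ≤ #(G.cliqueFinset (r + 1)) := by
    exact_mod_cast card_cliqueFinset_le_of_embedding φ (r + 1)
  refine hφ.trans' ?_
  rw [div_mul_eq_mul_div, ← mul_pow, div_le_iff₀ (by positivity), mul_comm (_ : ℝ) ((_ : ℕ) : ℝ)]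
  exact h

theorem le_card_edgeFinset_turanGraph {n r : ℕ} (hr : 2 ≤ r) :
    (1 - 1 / r) * (n : ℝ) ^ 2 / 2 - r ≤ #(turanGraph n r).edgeFinset := by
  have hr₂ : (2 : ℝ) ≤ r := by exact_mod_cast hr
  have hr₀ : (0 : ℝ) < r := by linarith
  have hs : n % r ≤ n := Nat.mod_le n r
  have hsr : ((n % r : ℕ) : ℝ) ≤ r := by exact_mod_cast (Nat.mod_lt n (by lia)).le
  have h := Nat.lt_div_mul_add (a := (n ^ 2 - (n % r) ^ 2) * (r - 1)) (b := 2 * r) (by lia)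
  have h₁ : (((n : ℝ) ^ 2 - (n % r : ℕ) ^ 2) * (r - 1)) / (2 * r) - 1 ≤
      (((n ^ 2 - (n % r) ^ 2) * (r - 1) / (2 * r) : ℕ) : ℝ) := by
    rw [sub_le_iff_le_add, div_le_iff₀ (by positivity)]
    have := (Nat.cast_lt (α := ℝ)).2 h
    rw [Nat.cast_mul, Nat.cast_sub (Nat.pow_le_pow_left hs 2), Nat.cast_sub (by lia)] at this
    push_cast at this ⊢
    linarith
  rw [card_edgeFinset_turanGraph]
  push_cast
  rw [Nat.cast_choose_two]
  generalize ((n % r : ℕ) : ℝ) = s at *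
  have h₂ : ((n : ℝ) ^ 2 - s ^ 2) * (r - 1) / (2 * r) + s * (s - 1) / 2 =
      (1 - 1 / r) * (n : ℝ) ^ 2 / 2 - s * (r - s) / (2 * r) := by
    field_simp; ring
  have h₃ : s * (r - s) / (2 * r) ≤ r / 2 := by
    rw [div_le_div_iff₀ (by positivity) (by positivity)]
    nlinarith [sq_nonneg (s - (r - s))]
  linarith

theorem card_edgeFinset_turanGraph_le {n r : ℕ} (hr : 1 ≤ r) :
    (#(turanGraph n r).edgeFinset : ℝ) ≤ (1 - 1 / r) * (n : ℝ) ^ 2 / 2 := by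
  have hr₀ : (0 : ℝ) < r := by exact_mod_cast hr
  have h := (Nat.cast_le (α := ℝ)).2 (mul_card_edgeFinset_turanGraph_le (n := n) (r := r))
  push_cast [Nat.cast_sub hr] at h
  have h₂ : (1 - 1 / (r : ℝ)) * (n : ℝ) ^ 2 / 2 = (r - 1) * n ^ 2 / (2 * r) := by
    field_simp
  rw [h₂, le_div_iff₀ (by positivity)]
  linarith

theorem card_edgeFinset_turanGraph_sub_le {n r : ℕ} (hr : 2 ≤ r) (hn : 1 ≤ n) :
    (1 - 1 / (r : ℝ)) * n - (r + 1) ≤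
      (#(turanGraph n r).edgeFinset : ℝ) - #(turanGraph (n - 1) r).edgeFinset := by
  have h₁ := le_card_edgeFinset_turanGraph (n := n) hr
  have h₂ := card_edgeFinset_turanGraph_le (n := n - 1) (r := r) (by lia)
  rw [Nat.cast_sub hn] at h₂
  have h₃ : 0 < 1 / (r : ℝ) := one_div_pos.2 (by exact_mod_cast (by lia : 0 < r))
  push_cast at h₂
  linarith

theorem CliqueFree.card_edgeFinset_le_turanGraph {V : Type*} [Fintype V] {G : SimpleGraph V}
    [DecidableRel G.Adj] {r : ℕ} (hG : G.CliqueFree (r + 1)) :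
    #G.edgeFinset ≤ #(turanGraph (Fintype.card V) r).edgeFinset := by
  rw [card_edgeFinset_turanGraph]
  exact hG.card_edgeFinset_le

theorem CliqueFree.nonempty_iso_turanGraph {V : Type*} [Fintype V] {G : SimpleGraph V}
    [DecidableRel G.Adj] {r : ℕ} (hG : G.CliqueFree (r + 1))
    (h : #(turanGraph (Fintype.card V) r).edgeFinset ≤ #G.edgeFinset) :
    Nonempty (G ≃g turanGraph (Fintype.card V) r) := by
  refine IsTuranMaximal.nonempty_iso_turanGraph ⟨hG, fun H _ hH ↦ ?_⟩
  exact hH.card_edgeFinset_le_turanGraph.trans h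

/-- A large graph with at least as many edges as the Turán graph which contains a `K_{r+1}` either
contains many of them or has an edge in many of them. -/
theorem le_card_cliqueFinset_or_exists_adj {r : ℕ} (hr : 2 ≤ r) {η : ℝ} (hη : 0 < η) (hη₁ : η ≤ 1 / 2) :
    ∃ N δ : ℝ, 0 < δ ∧ ∀ {V : Type u} [Fintype V] [DecidableEq V] (G : SimpleGraph V)
      [DecidableRel G.Adj], N ≤ Fintype.card V → ¬ G.CliqueFree (r + 1) →
      #(turanGraph (Fintype.card V) r).edgeFinset ≤ #G.edgeFinset →
      δ * Fintype.card V ^ (r + 1) ≤ #(G.cliqueFinset (r + 1)) ∨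
      ∃ u v, G.Adj u v ∧
        (1 - 2 * η) * (((r : ℝ) - 1) / r ^ 2) ^ (r - 1) * (Fintype.card V : ℝ) ^ (r - 1) ≤
          #{s ∈ G.cliqueFinset (r + 1) | u ∈ s ∧ v ∈ s} := by
  have hr₂ : (2 : ℝ) ≤ r := by exact_mod_cast hr
  have hr₀ : (0 : ℝ) < r := by linarith
  obtain ⟨ε, hε, δ, hδ, key⟩ := exists_adj_of_card_le.{u} hr hη
  set c : ℝ := ε * η / (8 * r) with hc
  have hc₀ : 0 < c := by positivity
  refine ⟨max (max 1 (4 * (r + 1) / ε)) (r / c),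
    min (δ / 2 ^ (r + 1)) ((c / 4) ^ (r + 1) / (r + 1).factorial), by positivity,
    fun {V} _ _ G _ hN hG hE ↦ ?_⟩
  set n : ℝ := (Fintype.card V : ℝ) with hn
  obtain ⟨⟨hn₁, hnε⟩, hnc⟩ : (1 ≤ n ∧ 4 * (r + 1) / ε ≤ n) ∧ r / c ≤ n := by
    simpa only [max_le_iff] using hN
  have hn₀ : 0 < n := by linarith
  rw [div_le_iff₀ hε] at hnε
  rw [div_le_iff₀ hc₀] at hnc
  obtain ⟨W, _, _, H, _, ⟨φ⟩, hHE, hdeg⟩ := exists_embedding_le_degree G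
    fun t ↦ (#(turanGraph t r).edgeFinset : ℝ) - ε / 4 * n * t
  have hWV : Fintype.card W ≤ Fintype.card V := Fintype.card_le_of_embedding φ.toEmbedding
  have hφ : (#(H.cliqueFinset (r + 1)) : ℝ) ≤ #(G.cliqueFinset (r + 1)) := by
    exact_mod_cast card_cliqueFinset_le_of_embedding φ (r + 1)
  set m : ℝ := (Fintype.card W : ℝ) with hm
  have hmn : m ≤ n := by rw [hm, hn]; exact_mod_cast hWV
  have hE' : (#(turanGraph (Fintype.card V) r).edgeFinset : ℝ) ≤ #G.edgeFinset := by
    exact_mod_cast hE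
  have hHE' : #(turanGraph (Fintype.card W) r).edgeFinset + ε / 4 * n * (n - m) ≤
      (#H.edgeFinset : ℝ) := by linarith
  by_cases hH : H.CliqueFree (r + 1)
  · have h₁ : (#H.edgeFinset : ℝ) ≤ #(turanGraph (Fintype.card W) r).edgeFinset := by
      exact_mod_cast hH.card_edgeFinset_le_turanGraph
    have h₂ : ε / 4 * n * (n - m) ≤ 0 := by linarith
    have h₃ : n ≤ m := by
      by_contra! h
      exact h₂.not_gt (mul_pos (by positivity) (by linarith))
    have h₄ : Function.Bijective φ := (Fintype.bijective_iff_injective_and_card φ).2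
      ⟨φ.injective, hWV.antisymm (Nat.cast_le.1 h₃)⟩
    exact absurd (hH.comap ⟨Iso.toCopy (RelIso.ofSurjective φ h₄.2).symm⟩) hG
  by_cases hnm : (1 - η / r) * n ≤ m
  swap
  · left
    push Not at hnm
    have h₁ := le_card_edgeFinset_turanGraph (n := Fintype.card W) hr
    have h₂ : ε / 4 * n * (η / r * n) ≤ ε / 4 * n * (n - m) := by gcongr; linarith
    have h₃ : ε / 4 * n * (η / r * n) = 2 * (c * n ^ 2) := by simp only [hc]; field_simp; norm_num
    have h₄ : n * c * 1 ≤ n * c * n := by gcongr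
    rw [← hm] at h₁
    have := H.le_card_cliqueFinset_of_le_card_edgeFinset (r := r) (n := n) (by lia) hc₀
      (by linarith) hmn (by linarith)
    refine hφ.trans' (this.trans' ?_)
    gcongr
    exact min_le_right _ _
  have hηr : η / r ≤ 1 / 2 := by
    rw [div_le_iff₀ hr₀]; linarith
  have hm₂ : n / 2 ≤ m := by nlinarith
  have hm₀ : 0 < m := by linarith
  by_cases hHδ : (#(H.cliqueFinset (r + 1)) : ℝ) ≤ δ * m ^ (r + 1)
  swap
  · left
    refine hφ.trans' ((not_le.1 hHδ).le.trans' ?_)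
    calc _ ≤ δ / 2 ^ (r + 1) * n ^ (r + 1) := by gcongr; exact min_le_left _ _
      _ = δ * (n / 2) ^ (r + 1) := by rw [div_pow]; ring
      _ ≤ _ := by gcongr
  right
  have hW : 0 < Fintype.card W := by rw [← Nat.cast_pos (α := ℝ)]; exact hm₀
  have : Nonempty W := Fintype.card_pos_iff.1 hW
  obtain ⟨u, v, huv, h⟩ := key H (fun v ↦ (hdeg v).trans' (by
    have h₁ := card_edgeFinset_turanGraph_sub_le (n := Fintype.card W) hr hW
    rw [← hm] at h₁ ⊢
    rw [Nat.cast_sub hW]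
    push_cast
    have h₂ : ε * (n / 2) ≤ ε * m := by gcongr
    have h₃ : 0 ≤ ε / 4 * n := by positivity
    linarith)) hHδ hH
  refine ⟨φ u, φ v, φ.map_adj_iff.2 huv, ?_⟩
  refine (Nat.cast_le.2 (card_cliqueFinset_filter_le_of_embedding φ (r + 1) u v)).trans'
    (h.trans' ?_)
  have h₁ : 1 - η ≤ (1 - η / r) ^ (r - 1) := by
    have h₂ := one_add_mul_le_pow (a := -(η / r)) (by linarith) (r - 1)
    rw [Nat.cast_sub (by lia), ← sub_eq_add_neg] at h₂
    refine h₂.trans' ?_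
    have h₃ : η / r * r = η := by field_simp
    have h₄ : 0 ≤ η / r := by positivity
    push_cast
    linarith
  have h₂ : (0 : ℝ) ≤ (r - 1) / r ^ 2 := div_nonneg (by linarith) (by positivity)
  calc _ ≤ (1 - η) * (1 - η / r) ^ (r - 1) * (((r : ℝ) - 1) / r ^ 2) ^ (r - 1) * n ^ (r - 1) := by
        gcongr
        nlinarith [sq_nonneg η]
    _ = (1 - η) * (((r : ℝ) - 1) / r ^ 2) ^ (r - 1) * ((1 - η / r) * n) ^ (r - 1) := by
        rw [mul_pow]; ring
    _ ≤ _ := by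
        gcongr
        · exact mul_nonneg (by linarith) (pow_nonneg h₂ _)
        · exact mul_nonneg (by linarith) hn₀.le

end SimpleGraph

/-- For each `r ≥ 2` and `η > 0` there is `δ > 0` such that every graph `G` on `n` vertices
with at least `t_r(n)` edges either is the Turán graph `T_{n,r}`, or contains at least
`δ n^{r+1}` copies of `K_{r+1}`, or has an edge in at least
`(1-η) ((r-1)/r²)^{r-1} n^{r-1}` copies of `K_{r+1}`. -/
theorem joints_and_cliques (r : ℕ) (hr : 2 ≤ r) (η : ℝ) (hη : 0 < η) :
    ∃ δ : ℝ, 0 < δ ∧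
      ∀ n : ℕ, 0 < n → ∀ (G : SimpleGraph (Fin n)) [DecidableRel G.Adj],
        (SimpleGraph.turanGraph n r).edgeFinset.card ≤ G.edgeFinset.card →
        (Nonempty (G ≃g SimpleGraph.turanGraph n r) ∨
          δ * (n : ℝ) ^ (r + 1) ≤ ((G.cliqueFinset (r + 1)).card : ℝ) ∨
          ∃ u v : Fin n, G.Adj u v ∧
            (1 - η) * (((r : ℝ) - 1) / (r : ℝ) ^ 2) ^ (r - 1) * (n : ℝ) ^ (r - 1) ≤
              (((G.cliqueFinset (r + 1)).filter (fun s => u ∈ s ∧ v ∈ s)).card : ℝ)) := by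
  obtain ⟨N, δ, hδ, key⟩ := SimpleGraph.le_card_cliqueFinset_or_exists_adj hr (η := min η 1 / 2)
    (by positivity) (by linarith [min_le_right η 1])
  refine ⟨min δ (1 / (max N 1) ^ (r + 1)), by positivity, fun n hn G _ hE ↦ ?_⟩
  have hE' : #(SimpleGraph.turanGraph (Fintype.card (Fin n)) r).edgeFinset ≤ #G.edgeFinset := by
    convert hE <;> exact Fintype.card_fin n
  by_cases hG : G.CliqueFree (r + 1)
  · left
    have := hG.nonempty_iso_turanGraph hE'
    rwa [Fintype.card_fin] at this
  right
  by_cases hN : N ≤ n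
  · refine (key G (by simpa using hN) hG hE').imp (fun h ↦ ?_) ?_
    · rw [Fintype.card_fin] at h
      refine h.trans' ?_
      gcongr
      exact min_le_left _ _
    · rintro ⟨u, v, huv, h⟩
      refine ⟨u, v, huv, ?_⟩
      rw [Fintype.card_fin] at h
      refine h.trans' ?_
      have hr₂ : (2 : ℝ) ≤ r := by exact_mod_cast hr
      have h₂ : (0 : ℝ) ≤ (r - 1) / r ^ 2 := div_nonneg (by linarith) (by positivity)
      gcongr
      linarith [min_le_left η 1]
  · left
    have h₁ : (1 : ℝ) ≤ #(G.cliqueFinset (r + 1)) := by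
      rw [← G.cliqueFinset_eq_empty_iff, ← Ne, ← nonempty_iff_ne_empty, ← card_pos] at hG
      exact_mod_cast hG
    refine h₁.trans' ?_
    calc _ ≤ 1 / (max N 1) ^ (r + 1) * (max N 1) ^ (r + 1) := by
          gcongr
          · exact min_le_right _ _
          · exact (not_le.1 hN).le.trans (le_max_left _ _)
      _ = 1 := by field_simp
end

section
/- Let 2 ≤ s ≤ t be integers and let G be a simple graph on vertex set ℕ (the positive integers) that contains no copy of the complete bipartite graph K_{s,t}, i.e., there do not exist disjoint vertex sets A of size s and B of size t with every vertex of A adjacent to every vertex of B. For each n, let G_n denote the induced subgraph of G on {1, 2, …, n} and let δ(G_n) denote its minimum degree. Then liminf_{n→∞} δ(G_n) / (n^{1−1/s} / (log n)^{1/s}) < ∞, where log is the natural logarithm. -/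
open Finset in
/-- Abel summation: a nonnegative sequence whose partial sums are at least `B * m ^ a` for
`n ≤ m < M` has weighted sum at least of logarithmic size. -/
lemma log_le_sum_mul_rpow_neg {f : ℕ → ℝ} (hf : ∀ u, 0 ≤ f u) {a B : ℝ} (ha0 : 0 ≤ a)
    (ha1 : a ≤ 1) (hB : 0 ≤ B) {n M : ℕ} (hn : 1 ≤ n) (hnM : n ≤ M)
    (hD : ∀ m ∈ Ico n M, B * (m : ℝ) ^ a ≤ ∑ u ∈ Icc 1 m, f u) :
    B * (a / 2) * (Real.log M - Real.log n) ≤ ∑ u ∈ Icc 1 M, f u * (u : ℝ) ^ (-a) := by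
  suffices h : B * (a / 2) * (Real.log M - Real.log n) + (M : ℝ) ^ (-a) * ∑ u ∈ Icc 1 M, f u
      ≤ ∑ u ∈ Icc 1 M, f u * (u : ℝ) ^ (-a) by
    have : 0 ≤ (M : ℝ) ^ (-a) * ∑ u ∈ Icc 1 M, f u :=
      mul_nonneg (by positivity) (sum_nonneg fun u _ => hf u)
    linarith
  induction M, hnM using Nat.le_induction with
  | base =>
    rw [sub_self, mul_zero, zero_add, mul_sum]
    refine sum_le_sum fun u hu => ?_
    rw [mem_Icc] at hu
    rw [mul_comm]
    refine mul_le_mul_of_nonneg_left ?_ (hf u)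
    refine Real.rpow_le_rpow_of_nonpos (by exact_mod_cast hu.1) (by exact_mod_cast hu.2)
      (by linarith)
  | succ M hnM ih =>
    have ih := ih fun m hm => hD m (by rw [mem_Ico] at hm ⊢; omega)
    have hM := hD M (by rw [mem_Ico]; omega)
    rw [sum_Icc_succ_top (by omega), sum_Icc_succ_top (by omega)]
    have hMpos : (0 : ℝ) < M := by exact_mod_cast (by omega : 0 < M)
    have hM1 : (1 : ℝ) ≤ M := by exact_mod_cast (by omega : 1 ≤ M)
    push_cast
    have hlog : Real.log ((M : ℝ) + 1) - Real.log M ≤ 1 / M := by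
      rw [← Real.log_div (by positivity) (by positivity)]
      have := Real.log_le_sub_one_of_pos (show (0 : ℝ) < (M + 1) / M by positivity)
      calc _ ≤ _ := this
        _ = 1 / (M : ℝ) := by field_simp; ring
    have hbern : ((M : ℝ) / (M + 1)) ^ a ≤ 1 - a / (M + 1) := by
      have := rpow_one_add_le_one_add_mul_self (s := -(1 / ((M : ℝ) + 1))) (p := a)
        (by
          rw [neg_le_neg_iff, div_le_one (by positivity)]
          linarith) ha0 ha1
      convert this using 1
      · congr 1
        field_simp
        ring
      · ring
    have hdiff : (M : ℝ) ^ (-a) * (a / (M + 1)) ≤ (M : ℝ) ^ (-a) - ((M : ℝ) + 1) ^ (-a) := by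
      have hmul : ((M : ℝ) + 1) ^ (-a) = (M : ℝ) ^ (-a) * ((M : ℝ) / (M + 1)) ^ a := by
        rw [Real.div_rpow hMpos.le (by positivity), Real.rpow_neg hMpos.le,
          Real.rpow_neg (by positivity)]
        have : (0 : ℝ) < (M : ℝ) ^ a := by positivity
        field_simp
      rw [hmul]
      have : (0 : ℝ) ≤ (M : ℝ) ^ (-a) := by positivity
      nlinarith
    have hkey : B * (a / 2) * (Real.log ((M : ℝ) + 1) - Real.log M) ≤
        ((M : ℝ) ^ (-a) - ((M : ℝ) + 1) ^ (-a)) * ∑ u ∈ Icc 1 M, f u := by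
      calc B * (a / 2) * (Real.log ((M : ℝ) + 1) - Real.log M)
          ≤ B * (a / 2) * (1 / M) := by gcongr
        _ ≤ B * (a / (M + 1)) := by
            rw [mul_assoc]
            gcongr
            rw [div_mul_div_comm, mul_one]
            gcongr
            linarith
        _ = ((M : ℝ) ^ (-a) * (a / (M + 1))) * (B * (M : ℝ) ^ a) := by
            rw [Real.rpow_neg hMpos.le]
            have : (0 : ℝ) < (M : ℝ) ^ a := by positivity
            field_simp
        _ ≤ _ := by
            gcongr
            exact le_trans (by positivity) hdiff
    nlinarith

lemma pow_le_pow_mul_one_add_factorial_mul_choose (d s : ℕ) :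
    d ^ s ≤ s ^ s * (1 + s.factorial * d.choose s) := by
  rcases Nat.eq_zero_or_pos s with rfl | hs
  · simp
  rcases lt_or_ge d s with h | h
  · calc d ^ s ≤ s ^ s := Nat.pow_le_pow_left h.le s
      _ ≤ _ := Nat.le_mul_of_pos_right _ (by omega)
  · have h1 : d ≤ s * (d + 1 - s) := by
      obtain ⟨e, rfl⟩ := Nat.exists_eq_add_of_le h
      have : s + e + 1 - s = e + 1 := by omega
      rw [this]
      nlinarith
    calc d ^ s ≤ (s * (d + 1 - s)) ^ s := Nat.pow_le_pow_left h1 s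
      _ = s ^ s * (d + 1 - s) ^ s := mul_pow _ _ _
      _ ≤ s ^ s * d.descFactorial s := Nat.mul_le_mul_left _ (Nat.pow_sub_le_descFactorial d s)
      _ = s ^ s * (s.factorial * d.choose s) := by rw [Nat.descFactorial_eq_factorial_mul_choose]
      _ ≤ _ := Nat.mul_le_mul_left _ (by omega)

open Finset Classical in
/-- Kővári–Sós–Turán double counting of the stars with `s` leaves in `V` and centre in `W`. -/
lemma sum_choose_le_of_Kst_free {V : Type*} (G : SimpleGraph V) {s t : ℕ}
    (hfree : ¬ ∃ (A B : Finset V), A.card = s ∧ B.card = t ∧ Disjoint A B ∧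
      ∀ a ∈ A, ∀ b ∈ B, G.Adj a b) (V₀ W : Finset V) :
    ∑ u ∈ W, (#{v ∈ V₀ | G.Adj v u}).choose s ≤ t * (#V₀).choose s := by
  calc ∑ u ∈ W, (#{v ∈ V₀ | G.Adj v u}).choose s
      = ∑ u ∈ W, #{S ∈ V₀.powersetCard s | ∀ a ∈ S, G.Adj a u} := by
        refine sum_congr rfl fun u _ => ?_
        rw [← card_powersetCard]
        congr 1
        ext S
        simp only [mem_powersetCard, mem_filter, subset_iff]
        grind
    _ = ∑ S ∈ V₀.powersetCard s, #{u ∈ W | ∀ a ∈ S, G.Adj a u} :=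
        sum_card_bipartiteAbove_eq_sum_card_bipartiteBelow _
    _ ≤ ∑ S ∈ V₀.powersetCard s, t := by
        refine sum_le_sum fun S hS => ?_
        by_contra! h
        obtain ⟨B, hB, hBt⟩ := exists_subset_card_eq h.le
        have hadj : ∀ a ∈ S, ∀ b ∈ B, G.Adj a b := fun a ha b hb =>
          (mem_filter.1 (hB hb)).2 a ha
        exact hfree ⟨S, B, (mem_powersetCard.1 hS).2, hBt,
          disjoint_left.2 fun x hx hx' => G.loopless.irrefl x (hadj x hx x hx'), hadj⟩
    _ = t * (#V₀).choose s := by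
        rw [sum_const, card_powersetCard, smul_eq_mul, mul_comm]

open Finset Classical in
lemma sum_pow_le_of_Kst_free {V : Type*} (G : SimpleGraph V) {s t : ℕ}
    (hfree : ¬ ∃ (A B : Finset V), A.card = s ∧ B.card = t ∧ Disjoint A B ∧
      ∀ a ∈ A, ∀ b ∈ B, G.Adj a b) (V₀ W : Finset V) (hW : #W ≤ #V₀ ^ s) :
    ∑ u ∈ W, #{v ∈ V₀ | G.Adj v u} ^ s ≤ s ^ s * (1 + t) * #V₀ ^ s := by
  calc ∑ u ∈ W, #{v ∈ V₀ | G.Adj v u} ^ s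
      ≤ ∑ u ∈ W, s ^ s * (1 + s.factorial * (#{v ∈ V₀ | G.Adj v u}).choose s) :=
        sum_le_sum fun u _ => pow_le_pow_mul_one_add_factorial_mul_choose _ s
    _ = s ^ s * (#W + s.factorial * ∑ u ∈ W, (#{v ∈ V₀ | G.Adj v u}).choose s) := by
        rw [← mul_sum, sum_add_distrib, ← mul_sum, card_eq_sum_ones]
    _ ≤ s ^ s * (#V₀ ^ s + s.factorial * (t * (#V₀).choose s)) := by
        gcongr
        exact sum_choose_le_of_Kst_free G hfree V₀ W
    _ = s ^ s * (#V₀ ^ s + t * (#V₀).descFactorial s) := by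
        rw [Nat.descFactorial_eq_factorial_mul_choose]; ring
    _ ≤ s ^ s * (#V₀ ^ s + t * #V₀ ^ s) := by
        gcongr
        exact Nat.descFactorial_le_pow _ _
    _ = _ := by ring

open Finset in
lemma sum_mul_rpow_neg_le {f : ℕ → ℝ} (hf : ∀ u, 0 ≤ f u) {s : ℕ} (hs : 2 ≤ s) {M : ℕ} :
    ∑ u ∈ Icc 1 M, f u * (u : ℝ) ^ (-(1 - 1 / (s : ℝ))) ≤
      (∑ u ∈ Icc 1 M, f u ^ s) ^ (1 / (s : ℝ)) * (1 + Real.log M) ^ (1 - 1 / (s : ℝ)) := by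
  have hs1 : (1 : ℝ) < s := by exact_mod_cast hs
  have ha : 0 < 1 - 1 / (s : ℝ) := by
    rw [sub_pos, div_lt_one (by linarith)]
    exact hs1
  have hpq : (s : ℝ).HolderConjugate (1 / (1 - 1 / (s : ℝ))) := by
    rw [Real.holderConjugate_iff]
    exact ⟨hs1, by simp⟩
  have h := Real.inner_le_Lp_mul_Lq (Icc 1 M) f
    (fun u : ℕ => (u : ℝ) ^ (-(1 - 1 / (s : ℝ)))) hpq
  refine h.trans ?_
  rw [one_div_one_div]
  have hp : ∀ u, |f u| ^ (s : ℝ) = f u ^ s := fun u => by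
    rw [abs_of_nonneg (hf u), Real.rpow_natCast]
  have hq : ∀ u : ℕ, |(u : ℝ) ^ (-(1 - 1 / (s : ℝ)))| ^ (1 / (1 - 1 / (s : ℝ))) = (u : ℝ)⁻¹ := by
    intro u
    rw [abs_of_nonneg (by positivity), ← Real.rpow_mul (by positivity), neg_mul,
      mul_one_div_cancel ha.ne', Real.rpow_neg_one]
  simp only [hp, hq]
  have hharm : ∑ u ∈ Icc 1 M, (u : ℝ)⁻¹ ≤ 1 + Real.log M := by
    have := harmonic_le_one_add_log M
    rw [harmonic_eq_sum_Icc] at this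
    push_cast at this
    exact this
  have : ∀ u ∈ Icc 1 M, 0 ≤ f u ^ s := fun u _ => pow_nonneg (hf u) s
  have := sum_nonneg this
  gcongr

open Finset in
/-- If `f` has `s`-th power sum at most `K * n ^ s` up to `n ^ s`, its partial sums cannot all be
larger than about `K ^ (1 / s) * n * m ^ (1 - 1 / s) / (log n) ^ (1 / s)`. -/
lemma le_of_sum_pow_le_of_le_sum {f : ℕ → ℝ} (hf : ∀ u, 0 ≤ f u) {s n : ℕ} (hs : 2 ≤ s)
    (hn3 : 3 ≤ n) {K C : ℝ} (hK0 : 0 ≤ K) (hC0 : 0 ≤ C)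
    (hpow : ∑ u ∈ Icc 1 (n ^ s), f u ^ s ≤ K * (n : ℝ) ^ s)
    (hlow : ∀ m ∈ Ico n (n ^ s), (n * C / (Real.log (n ^ s : ℕ)) ^ (1 / (s : ℝ))) *
      (m : ℝ) ^ (1 - 1 / (s : ℝ)) ≤ ∑ u ∈ Icc 1 m, f u) :
    C ≤ 16 * K ^ (1 / (s : ℝ)) := by
  have hs2 : (2 : ℝ) ≤ s := by exact_mod_cast hs
  have hs_inv : 1 / (s : ℝ) ≤ 1 / 2 := by gcongr
  have hs_inv0 : 0 < 1 / (s : ℝ) := by positivity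
  have hnM : n ≤ n ^ s := Nat.le_self_pow (by omega) n
  have hn0 : (0 : ℝ) < n := by exact_mod_cast (by omega : 0 < n)
  have hLn : Real.log (n ^ s : ℕ) = s * Real.log n := by
    rw [Nat.cast_pow, Real.log_pow]
  have hupper := sum_mul_rpow_neg_le hf hs (M := n ^ s)
  have hlower := fun hB => log_le_sum_mul_rpow_neg hf (by linarith) (by linarith) hB
    (by omega) hnM hlow
  clear hlow
  generalize n ^ s = M at *
  generalize Real.log M = L at *
  have hlogn : 1 ≤ Real.log n := by
    rw [Real.le_log_iff_exp_le hn0]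
    have : (3 : ℝ) ≤ n := by exact_mod_cast hn3
    linarith [Real.exp_one_lt_three]
  have hL1 : 1 ≤ L := by nlinarith
  have hsub : L - Real.log n = (1 - 1 / (s : ℝ)) * L := by
    rw [hLn]
    field_simp
  have hLa : L / L ^ (1 / (s : ℝ)) = L ^ (1 - 1 / (s : ℝ)) := by
    rw [Real.rpow_sub (by linarith), Real.rpow_one]
  have hroot : (K * (n : ℝ) ^ s) ^ (1 / (s : ℝ)) = K ^ (1 / (s : ℝ)) * n := by
    rw [Real.mul_rpow hK0 (by positivity), one_div, Real.pow_rpow_inv_natCast hn0.le (by omega)]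
  have h0 : 0 ≤ ∑ u ∈ Icc 1 M, f u ^ s := sum_nonneg fun u _ => pow_nonneg (hf u) s
  replace hpow := Real.rpow_le_rpow h0 hpow hs_inv0.le
  rw [hroot] at hpow
  have hfin := (hlower (by positivity)).trans hupper
  rw [hsub] at hfin
  obtain ⟨a, ha⟩ : ∃ a, a = 1 - 1 / (s : ℝ) := ⟨_, rfl⟩
  rw [← ha] at hfin hLa
  have ha_half : 1 / 2 ≤ a := by linarith
  have ha1 : a ≤ 1 := by linarith
  have hL2 : (1 + L) ^ a ≤ 2 * L ^ a := by
    calc (1 + L) ^ a ≤ (2 * L) ^ a := by gcongr; linarith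
      _ = 2 ^ a * L ^ a := Real.mul_rpow (by norm_num) (by linarith)
      _ ≤ 2 ^ (1 : ℝ) * L ^ a := by gcongr; norm_num
      _ = 2 * L ^ a := by rw [Real.rpow_one]
  replace hfin := hfin.trans (mul_le_mul hpow hL2 (by positivity) (by positivity))
  have hX : 0 < n * L ^ a := by positivity
  rw [show n * C / L ^ (1 / (s : ℝ)) * (a / 2) * (a * L) =
      C * a ^ 2 / 2 * (n * L ^ a) by rw [← hLa]; ring,
    show K ^ (1 / (s : ℝ)) * n * (2 * L ^ a) = 2 * K ^ (1 / (s : ℝ)) * (n * L ^ a) by ring]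
    at hfin
  have hle := le_of_mul_le_mul_right hfin hX
  have ha2 : 1 / 4 ≤ a ^ 2 := by nlinarith
  nlinarith

open Finset Classical in
lemma le_of_Kst_free_of_le_degree {s t : ℕ} (hs : 2 ≤ s) (G : SimpleGraph ℕ)
    (hfree : ¬ ∃ (A B : Finset ℕ), A.card = s ∧ B.card = t ∧ Disjoint A B ∧
      ∀ a ∈ A, ∀ b ∈ B, G.Adj a b) {C : ℝ} (hC0 : 0 ≤ C) {n : ℕ} (hn3 : 3 ≤ n)
    (hdeg : ∀ m ≥ n, ∀ v ∈ Icc 1 m, C * (m : ℝ) ^ (1 - 1 / (s : ℝ)) ≤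
      #{u ∈ Icc 1 m | G.Adj v u} * Real.log m ^ (1 / (s : ℝ))) :
    C ≤ 16 * ((s : ℝ) ^ s * (1 + t)) ^ (1 / (s : ℝ)) := by
  refine le_of_sum_pow_le_of_le_sum (f := fun u => (#{v ∈ Icc 1 n | G.Adj v u} : ℝ))
    (fun u => Nat.cast_nonneg _) hs hn3 (by positivity) hC0 ?_ fun m hm => ?_
  · have h := sum_pow_le_of_Kst_free G hfree (Icc 1 n) (Icc 1 (n ^ s))
      (by rw [Nat.card_Icc, Nat.card_Icc, Nat.add_sub_cancel, Nat.add_sub_cancel])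
    rw [Nat.card_Icc, Nat.add_sub_cancel] at h
    exact_mod_cast h
  · rw [mem_Ico] at hm
    have hlogm : Real.log m ≤ Real.log (n ^ s : ℕ) :=
      Real.log_le_log (by exact_mod_cast (by omega : 0 < m)) (by exact_mod_cast hm.2.le)
    have hlogm0 : 0 < Real.log m := Real.log_pos (by exact_mod_cast (by omega : 1 < m))
    generalize Real.log (n ^ s : ℕ) = L at *
    have hL : 0 < L := by linarith
    have hswap : ∑ u ∈ Icc 1 m, #{v ∈ Icc 1 n | G.Adj v u} =
        ∑ v ∈ Icc 1 n, #{u ∈ Icc 1 m | G.Adj v u} :=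
      (sum_card_bipartiteAbove_eq_sum_card_bipartiteBelow _).symm
    rw [← Nat.cast_sum, hswap, Nat.cast_sum]
    calc _ = ∑ v ∈ Icc 1 n, C * (m : ℝ) ^ (1 - 1 / (s : ℝ)) / L ^ (1 / (s : ℝ)) := by
          rw [sum_const, Nat.card_Icc, nsmul_eq_mul, Nat.add_sub_cancel]
          ring
      _ ≤ _ := by
          refine sum_le_sum fun v hv => ?_
          rw [mem_Icc] at hv
          rw [div_le_iff₀ (by positivity)]
          exact (hdeg m hm.1 v (by rw [mem_Icc]; omega)).trans (by gcongr)


/-- If `2 ≤ s ≤ t` and `G` is a `K_{s,t}`-free graph on the positive integers, then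
`liminf_{n→∞} δ(G_n) / (n^{1-1/s} / (log n)^{1/s}) < ∞`, where `G_n` is the induced
subgraph on `{1, …, n}` and `δ` denotes minimum degree (natural logarithm). -/
theorem infinite_Kst_free_min_degree (s t : ℕ) (hs : 2 ≤ s) (hst : s ≤ t)
    (G : SimpleGraph ℕ)
    (hfree : ¬ ∃ (A B : Finset ℕ), A.card = s ∧ B.card = t ∧ Disjoint A B ∧
      ∀ a ∈ A, ∀ b ∈ B, G.Adj a b) :
    ∃ C : ℝ, ∀ N : ℕ, ∃ n ≥ N,
      ∃ v ∈ Finset.Icc 1 n,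
        ({u : ℕ | u ∈ Finset.Icc 1 n ∧ G.Adj v u}.ncard : ℝ) *
            (Real.log n) ^ ((1 : ℝ) / s) ≤
          C * (n : ℝ) ^ (1 - 1 / (s : ℝ)) := by
  classical
  refine ⟨16 * ((s : ℝ) ^ s * (1 + t)) ^ (1 / (s : ℝ)) + 1, ?_⟩
  by_contra! hcon
  obtain ⟨N, hN⟩ := hcon
  refine (lt_add_one (16 * ((s : ℝ) ^ s * (1 + t)) ^ (1 / (s : ℝ)))).not_ge ?_
  refine le_of_Kst_free_of_le_degree hs G hfree (by positivity) (le_max_right N 3)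
    fun m hm v hv => ?_
  have h := hN m ((le_max_left _ _).trans hm) v hv
  have hset : {u : ℕ | u ∈ Finset.Icc 1 m ∧ G.Adj v u} =
      ({u ∈ Finset.Icc 1 m | G.Adj v u} : Finset ℕ) := by
    ext u
    simp
  rw [hset, Set.ncard_coe_finset] at h
  convert h.le
end
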